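/- arXiv:1502.07158 — 10 statements merged into one kernel-verified Lean document; each statement's English description precedes it below -/
import Mathlib

section
/- Discrete time derivative estimate (Proposition 3.2). Let (U_i^{α,n}) be a discrete solution of the junction scheme, where each H_α is C¹ on ℝ and F is C¹ on ℝ^N with ∂F/∂p_β ≤ 0 everywhere for every β. Fix n ∈ ℕ and assume there is C with |p_{i,+}^{α,n}| ≤ C for all i ≥ 0 and all α. Assume the following CFL-type bounds: (a) for every α, every i ≥ 1, every σ ∈ {−,+} and every p in the closed interval with endpoints p_{i,σ}^{α,n} and p_{i,σ}^{α,n+1}, one has |H_α'(p)| ≤ Δx/Δt; (b) for every q ∈ ∏_β [min(p_{0,+}^{β,n}, p_{0,+}^{β,n+1}), max(p_{0,+}^{β,n}, p_{0,+}^{β,n+1})], one has −∑_β ∂F/∂p_β(q) ≤ Δx/Δt. Then for every i ≥ 0 and every α: inf_{j,β} W_j^{β,n} ≤ W_i^{α,n+1} ≤ sup_{j,β} W_j^{β,n}; in particular mⁿ ≤ m^{n+1} ≤ M^{n+1} ≤ Mⁿ, where mⁿ := inf_{α,i} W_i^{α,n} and Mⁿ := sup_{α,i} W_i^{α,n}.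 -/
open Set

noncomputable section

/-- Monotone envelope `H⁻(p) = H(min(p, p₀))`. -/
def Hm (H : ℝ → ℝ) (p0 p : ℝ) : ℝ := H (min p p0)

/-- Monotone envelope `H⁺(p) = H(max(p, p₀))`. -/
def Hp (H : ℝ → ℝ) (p0 p : ℝ) : ℝ := H (max p p0)

/-- Discrete gradient `p_{i,+}^{α,n}`. -/
def pPlus {N : ℕ} (dx : ℝ) (U : Fin N → ℕ → ℕ → ℝ) (α : Fin N) (i n : ℕ) : ℝ :=
  (U α (i + 1) n - U α i n) / dx

/-- Discrete gradient `p_{i,-}^{α,n}`. -/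
def pMinus {N : ℕ} (dx : ℝ) (U : Fin N → ℕ → ℕ → ℝ) (α : Fin N) (i n : ℕ) : ℝ :=
  (U α i n - U α (i - 1) n) / dx

/-- Discrete time derivative `W_i^{α,n}`. -/
def Wd {N : ℕ} (dt : ℝ) (U : Fin N → ℕ → ℕ → ℝ) (α : Fin N) (i n : ℕ) : ℝ :=
  (U α i (n + 1) - U α i n) / dt

/-- `(U_i^{α,n})` is a discrete solution of the junction scheme. -/
def IsDiscreteSol {N : ℕ} (H : Fin N → ℝ → ℝ) (p0 : Fin N → ℝ) (F : (Fin N → ℝ) → ℝ)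
    (dx dt : ℝ) (U : Fin N → ℕ → ℕ → ℝ) : Prop :=
  (∀ α β : Fin N, ∀ n : ℕ, U α 0 n = U β 0 n) ∧
  (∀ α : Fin N, ∀ n : ℕ, ∀ i : ℕ, 1 ≤ i →
    U α i (n + 1) = U α i n
      - dt * max (Hp (H α) (p0 α) (pMinus dx U α i n)) (Hm (H α) (p0 α) (pPlus dx U α i n))) ∧
  (∀ α : Fin N, ∀ n : ℕ,
    U α 0 (n + 1) = U α 0 n - dt * F (fun β => pPlus dx U β 0 n))

lemma aux_lip (H : ℝ → ℝ) (hH : ContDiff ℝ 1 H) (L a b x y : ℝ)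
    (hL : ∀ p ∈ uIcc a b, |deriv H p| ≤ L) (hx : x ∈ uIcc a b) (hy : y ∈ uIcc a b) :
    H y - H x ≤ L * |y - x| := by
  have h := (convex_uIcc a b).norm_image_sub_le_of_norm_deriv_le (f := H) (C := L)
    (fun p _ => (hH.differentiable (by norm_num)) p) (fun p hp => hL p hp) hx hy
  exact (le_abs_self _).trans h

lemma aux_Hp (H : ℝ → ℝ) (p0 : ℝ) (hH : ContDiff ℝ 1 H) (hm : MonotoneOn H (Ici p0))
    (L a b M : ℝ) (hL : ∀ p ∈ uIcc a b, |deriv H p| ≤ L) (hM : 0 ≤ M)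
    (hab : L * (b - a) ≤ M) : Hp H p0 b - Hp H p0 a ≤ M := by
  unfold Hp
  have hL0 : 0 ≤ L := (abs_nonneg _).trans (hL a left_mem_uIcc)
  rcases le_total b a with h | h
  · have := hm (le_max_right b p0) (le_max_right a p0) (max_le_max_right p0 h)
    linarith
  · rcases le_total b p0 with hb | hb
    · rw [max_eq_right hb, max_eq_right (h.trans hb)]; linarith
    · rw [max_eq_left hb]
      have h1 : max a p0 ≤ b := max_le h hb
      have := aux_lip H hH L a b (max a p0) b hL
        (by rw [uIcc_of_le h]; exact ⟨le_max_left _ _, h1⟩) right_mem_uIcc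
      rw [abs_of_nonneg (by linarith)] at this
      have h2 := mul_le_mul_of_nonneg_left (sub_le_sub_left (le_max_left a p0) b) hL0
      linarith

lemma aux_Hm (H : ℝ → ℝ) (p0 : ℝ) (hH : ContDiff ℝ 1 H) (hm : AntitoneOn H (Iic p0))
    (L a b M : ℝ) (hL : ∀ p ∈ uIcc a b, |deriv H p| ≤ L) (hM : 0 ≤ M)
    (hab : L * (a - b) ≤ M) : Hm H p0 b - Hm H p0 a ≤ M := by
  unfold Hm
  have hL0 : 0 ≤ L := (abs_nonneg _).trans (hL a left_mem_uIcc)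
  rcases le_total a b with h | h
  · have := hm (min_le_right a p0) (min_le_right b p0) (min_le_min_right p0 h)
    linarith
  · rcases le_total p0 b with hb | hb
    · rw [min_eq_right hb, min_eq_right (hb.trans h)]; linarith
    · rw [min_eq_left hb]
      have h1 : b ≤ min a p0 := le_min h hb
      have := aux_lip H hH L a b (min a p0) b hL
        (by rw [uIcc_of_ge h]; exact ⟨h1, min_le_left _ _⟩) right_mem_uIcc
      rw [abs_of_nonpos (by linarith)] at this
      have h2 := mul_le_mul_of_nonneg_left (sub_le_sub_right (min_le_left a p0) b) hL0
      linarith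

lemma aux_max (A B A' B' M : ℝ) (h1 : A' - A ≤ M) (h2 : B' - B ≤ M) :
    max A' B' - max A B ≤ M := by
  have := le_max_left A B
  have := le_max_right A B
  have : max A' B' ≤ M + max A B := max_le (by linarith) (by linarith)
  linarith

lemma aux_F {N : ℕ} (F : (Fin N → ℝ) → ℝ) (hF : ContDiff ℝ 1 F) (p p' : Fin N → ℝ) :
    ∃ q : Fin N → ℝ, (∀ β, q β ∈ uIcc (p β) (p' β)) ∧
      F p' - F p = ∑ β, fderiv ℝ F q (Pi.single β 1) * (p' β - p β) := by
  obtain ⟨q, hq, he⟩ := domain_mvt (f := F) (f' := fun x => fderiv ℝ F x) (s := univ)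
    (x := p) (y := p')
    (fun x _ => ((hF.differentiable (by norm_num)) x).hasFDerivAt.hasFDerivWithinAt)
    convex_univ (mem_univ _) (mem_univ _)
  refine ⟨q, fun β => ?_, ?_⟩
  · rw [← segment_eq_uIcc]
    obtain ⟨a, b, ha, hb, hab, rfl⟩ := hq
    exact ⟨a, b, ha, hb, hab, by simp⟩
  · rw [he]
    conv_lhs => rw [← Finset.univ_sum_single (p' - p)]
    rw [map_sum]
    refine Finset.sum_congr rfl fun β _ => ?_
    have : Pi.single β ((p' - p) β) = ((p' - p) β) • (Pi.single β (1:ℝ) : Fin N → ℝ) := by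
      rw [← Pi.single_smul]; simp
    rw [this, map_smul, smul_eq_mul, mul_comm, Pi.sub_apply]

/-- Proposition 3.2: discrete time derivative estimate.  The conclusion
`inf_{j,β} W_j^{β,n} ≤ W_i^{α,n+1} ≤ sup_{j,β} W_j^{β,n}` is expressed by: every lower
(resp. upper) bound of the `W^n`'s is a lower (resp. upper) bound of the `W^{n+1}`'s. -/
theorem stmt1 (N : ℕ) (hN : 1 ≤ N) (dx dt : ℝ) (hdx : 0 < dx) (hdt : 0 < dt)
    (H : Fin N → ℝ → ℝ) (p0 : Fin N → ℝ)
    (hHC1 : ∀ α, ContDiff ℝ 1 (H α))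
    (hHanti : ∀ α, AntitoneOn (H α) (Iic (p0 α)))
    (hHmono : ∀ α, MonotoneOn (H α) (Ici (p0 α)))
    (F : (Fin N → ℝ) → ℝ)
    (hFC1 : ContDiff ℝ 1 F)
    (hFdec : ∀ (p : Fin N → ℝ) (β : Fin N), fderiv ℝ F p (Pi.single β 1) ≤ 0)
    (U : Fin N → ℕ → ℕ → ℝ)
    (hU : IsDiscreteSol H p0 F dx dt U)
    (n : ℕ) (C : ℝ)
    (hbound : ∀ α : Fin N, ∀ i : ℕ, |pPlus dx U α i n| ≤ C)
    -- (a): CFL bound for the Hamiltonians along the relevant intervals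
    (hCFLint : ∀ α : Fin N, ∀ i : ℕ, 1 ≤ i →
      (∀ p ∈ uIcc (pPlus dx U α i n) (pPlus dx U α i (n + 1)), |deriv (H α) p| ≤ dx / dt) ∧
      (∀ p ∈ uIcc (pMinus dx U α i n) (pMinus dx U α i (n + 1)), |deriv (H α) p| ≤ dx / dt))
    -- (b): CFL bound for the junction function on the relevant box
    (hCFLjun : ∀ q : Fin N → ℝ,
      (∀ β, q β ∈ uIcc (pPlus dx U β 0 n) (pPlus dx U β 0 (n + 1))) →
      -∑ β, fderiv ℝ F q (Pi.single β 1) ≤ dx / dt) :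
    (∀ K : ℝ, (∀ β : Fin N, ∀ j : ℕ, K ≤ Wd dt U β j n) →
      ∀ α : Fin N, ∀ i : ℕ, K ≤ Wd dt U α i (n + 1)) ∧
    (∀ K : ℝ, (∀ β : Fin N, ∀ j : ℕ, Wd dt U β j n ≤ K) →
      ∀ α : Fin N, ∀ i : ℕ, Wd dt U α i (n + 1) ≤ K) := by
  obtain ⟨h0, hint, hjun⟩ := hU
  have hLp : ∀ α i, dx / dt * (pPlus dx U α i (n+1) - pPlus dx U α i n)
      = Wd dt U α (i+1) n - Wd dt U α i n := by
    intro α i; unfold pPlus Wd; field_simp; ring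
  have hLm : ∀ α i, dx / dt * (pMinus dx U α i (n+1) - pMinus dx U α i n)
      = Wd dt U α i n - Wd dt U α (i-1) n := by
    intro α i; unfold pMinus Wd; field_simp; ring
  have hWi : ∀ α m i, 1 ≤ i → Wd dt U α i m =
      - max (Hp (H α) (p0 α) (pMinus dx U α i m)) (Hm (H α) (p0 α) (pPlus dx U α i m)) := by
    intro α m i hi
    unfold Wd; rw [hint α m i hi]; field_simp; ring
  have hW0 : ∀ α m, Wd dt U α 0 m = - F (fun β => pPlus dx U β 0 m) := by
    intro α m
    unfold Wd; rw [hjun α m]; field_simp; ring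
  obtain ⟨q, hq, hFq⟩ := aux_F F hFC1 (fun β => pPlus dx U β 0 n)
    (fun β => pPlus dx U β 0 (n+1))
  have hS := hCFLjun q hq
  have hL : 0 < dx / dt := div_pos hdx hdt
  have hWW : ∀ α β, Wd dt U α 0 n = Wd dt U β 0 n := fun α β => by rw [hW0, hW0]
  -- junction identity
  have key : ∀ α K, (dx/dt) * (Wd dt U α 0 (n+1) - K) =
      (dx/dt + ∑ β, fderiv ℝ F q (Pi.single β 1)) * (Wd dt U α 0 n - K)
      + ∑ β, (- fderiv ℝ F q (Pi.single β 1)) * (Wd dt U β 1 n - K) := by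
    intro α K
    have e1 : Wd dt U α 0 (n+1) = Wd dt U α 0 n -
        ∑ β, fderiv ℝ F q (Pi.single β 1) * (pPlus dx U β 0 (n+1) - pPlus dx U β 0 n) := by
      rw [← hFq, hW0, hW0]; ring
    have e2 : (dx/dt) * ∑ β, fderiv ℝ F q (Pi.single β 1) *
        (pPlus dx U β 0 (n+1) - pPlus dx U β 0 n)
        = ∑ β, fderiv ℝ F q (Pi.single β 1) * (Wd dt U β 1 n - K)
          - (∑ β, fderiv ℝ F q (Pi.single β 1)) * (Wd dt U α 0 n - K) := by
      rw [Finset.mul_sum, Finset.sum_mul, ← Finset.sum_sub_distrib]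
      refine Finset.sum_congr rfl fun β _ => ?_
      have := hLp β 0
      rw [hWW β α] at this
      simp only [zero_add] at this
      linear_combination (fderiv ℝ F q (Pi.single β 1)) * this
    simp only [neg_mul, Finset.sum_neg_distrib]
    rw [e1]
    linear_combination -e2
  constructor
  · intro K hK α i
    rcases Nat.eq_zero_or_pos i with rfl | hi
    · have : 0 ≤ (dx/dt) * (Wd dt U α 0 (n+1) - K) := by
        rw [key]
        exact add_nonneg (mul_nonneg (by linarith) (by linarith [hK α 0]))
          (Finset.sum_nonneg fun β _ => mul_nonneg (by linarith [hFdec q β])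
            (by linarith [hK β 1]))
      linarith [nonneg_of_mul_nonneg_right this hL]
    · have hM : 0 ≤ Wd dt U α i n - K := by linarith [hK α i]
      have := aux_max _ _ _ _ _
        (aux_Hp (H α) (p0 α) (hHC1 α) (hHmono α) (dx/dt) (pMinus dx U α i n)
          (pMinus dx U α i (n+1)) (Wd dt U α i n - K) (hCFLint α i hi).2 hM
          (by linarith [hLm α i, hK α (i-1)]))
        (aux_Hm (H α) (p0 α) (hHC1 α) (hHanti α) (dx/dt) (pPlus dx U α i n)
          (pPlus dx U α i (n+1)) (Wd dt U α i n - K) (hCFLint α i hi).1 hM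
          (by linarith [hLp α i, hK α (i+1)]))
      linarith [hWi α n i hi, hWi α (n+1) i hi]
  · intro K hK α i
    rcases Nat.eq_zero_or_pos i with rfl | hi
    · have : (dx/dt) * (Wd dt U α 0 (n+1) - K) ≤ 0 := by
        rw [key]
        exact add_nonpos (mul_nonpos_of_nonneg_of_nonpos (by linarith) (by linarith [hK α 0]))
          (Finset.sum_nonpos fun β _ => mul_nonpos_of_nonneg_of_nonpos
            (by linarith [hFdec q β]) (by linarith [hK β 1]))
      have := nonpos_of_mul_nonpos_right this hL
      linarith
    · have hM : 0 ≤ K - Wd dt U α i n := by linarith [hK α i]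
      have := aux_max _ _ _ _ _
        (aux_Hp (H α) (p0 α) (hHC1 α) (hHmono α) (dx/dt) (pMinus dx U α i (n+1))
          (pMinus dx U α i n) (K - Wd dt U α i n)
          (by rw [uIcc_comm]; exact (hCFLint α i hi).2) hM
          (by linarith [hLm α i, hK α (i-1)]))
        (aux_Hm (H α) (p0 α) (hHC1 α) (hHanti α) (dx/dt) (pPlus dx U α i (n+1))
          (pPlus dx U α i n) (K - Wd dt U α i n)
          (by rw [uIcc_comm]; exact (hCFLint α i hi).1) hM
          (by linarith [hLp α i, hK α (i+1)]))
      linarith [hWi α n i hi, hWi α (n+1) i hi]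
end
end

section
/- Discrete gradient estimate from a lower bound on the discrete time derivative (Proposition 3.3). Let (U_i^{α,n}) be a discrete solution of the junction scheme, where each H_α is continuous, coercive (H_α(p) → +∞ as |p| → +∞) and nonincreasing on (−∞, p₀^α], nondecreasing on [p₀^α, +∞); set A_α := H_α(p₀^α) = min H_α and for a ∈ ℝ define π_α⁺(a) := sup{ p : H_α⁺(p) = max(a, A_α) } and π_α⁻(a) := inf{ p : H_α⁻(p) = max(a, A_α) }. Fix n ∈ ℕ and K ∈ ℝ, and assume K ≤ W_i^{α,n} for all i ≥ 0 and all α. Assume moreover b₁,…,b_N ∈ ℝ are such that for every p ∈ ℝ^N, F(p) ≤ −K implies p_α ≥ b_α for every α. Then: for every α and every i ≥ 1, π_α⁻(−K) ≤ p_{i,+}^{α,n} ≤ π_α⁺(−K); and for every α, b_α ≤ p_{0,+}^{α,n} ≤ π_α⁺(−K). -/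
open Set

noncomputable section

/-- Generalized inverse `π⁺(a) = sup { p : H⁺(p) = max(a, A₀) }` where `A₀ = H(p₀)`. -/
def piPlus (H : ℝ → ℝ) (p0 a : ℝ) : ℝ :=
  sSup {p : ℝ | Hp H p0 p = max a (H p0)}

/-- Generalized inverse `π⁻(a) = inf { p : H⁻(p) = max(a, A₀) }` where `A₀ = H(p₀)`. -/
def piMinus (H : ℝ → ℝ) (p0 a : ℝ) : ℝ :=
  sInf {p : ℝ | Hm H p0 p = max a (H p0)}

theorem le_piPlus_aux (H : ℝ → ℝ) (p0 a p : ℝ) (hc : Continuous H)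
    (hco : ∀ M : ℝ, ∃ R : ℝ, ∀ p : ℝ, R ≤ |p| → M ≤ H p)
    (hp : Hp H p0 p ≤ a) : p ≤ piPlus H p0 a := by
  obtain ⟨R, hR⟩ := hco (max a (H p0) + 1)
  have hbig : ∀ q, |R| + |p0| ≤ q → max a (H p0) + 1 ≤ Hp H p0 q := by
    intro q hq
    have h1 := le_abs_self R
    have h2 := le_abs_self p0
    have h3 := abs_nonneg R
    have h4 := abs_nonneg p0
    unfold Hp
    rw [max_eq_left (show p0 ≤ q by linarith)]
    exact hR q (by linarith [le_abs_self q])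
  have hcont : Continuous (Hp H p0) := by
    unfold Hp
    exact hc.comp (continuous_id.max continuous_const)
  have hle : p ≤ max p (|R| + |p0|) := le_max_left _ _
  have hB := hbig (max p (|R| + |p0|)) (le_max_right _ _)
  obtain ⟨q, hq, hqe⟩ := intermediate_value_Icc hle hcont.continuousOn
    (show max a (H p0) ∈ Icc _ _ from ⟨hp.trans (le_max_left _ _), by linarith⟩)
  refine hq.1.trans (le_csSup ⟨|R| + |p0|, ?_⟩ hqe)
  intro r hr
  by_contra hlt
  have h5 := hbig r (not_le.mp hlt).le
  have h6 : Hp H p0 r = max a (H p0) := hr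
  linarith

theorem piMinus_le_aux (H : ℝ → ℝ) (p0 a p : ℝ) (hc : Continuous H)
    (hco : ∀ M : ℝ, ∃ R : ℝ, ∀ p : ℝ, R ≤ |p| → M ≤ H p)
    (hp : Hm H p0 p ≤ a) : piMinus H p0 a ≤ p := by
  obtain ⟨R, hR⟩ := hco (max a (H p0) + 1)
  have hbig : ∀ q, q ≤ -(|R| + |p0|) → max a (H p0) + 1 ≤ Hm H p0 q := by
    intro q hq
    have h1 := le_abs_self R
    have h2 := neg_abs_le p0
    have h3 := abs_nonneg R
    have h4 := abs_nonneg p0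
    unfold Hm
    rw [min_eq_left (show q ≤ p0 by linarith)]
    exact hR q (by linarith [neg_le_abs q])
  have hcont : Continuous (Hm H p0) := by
    unfold Hm
    exact hc.comp (continuous_id.min continuous_const)
  have hle : min p (-(|R| + |p0|)) ≤ p := min_le_left _ _
  have hB := hbig (min p (-(|R| + |p0|))) (min_le_right _ _)
  obtain ⟨q, hq, hqe⟩ := intermediate_value_Icc' hle hcont.continuousOn
    (show max a (H p0) ∈ Icc _ _ from ⟨hp.trans (le_max_left _ _), by linarith⟩)
  refine le_trans (csInf_le ⟨-(|R| + |p0|), ?_⟩ (show q ∈ {p : ℝ | Hm H p0 p = max a (H p0)} from hqe)) hq.2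
  intro r hr
  by_contra hlt
  have h5 := hbig r (not_le.mp hlt).le
  have h6 : Hm H p0 r = max a (H p0) := hr
  linarith

/-- Proposition 3.3: discrete gradient estimate from a lower bound on the discrete
time derivative. -/
theorem stmt2 (N : ℕ) (hN : 1 ≤ N) (dx dt : ℝ) (hdx : 0 < dx) (hdt : 0 < dt)
    (H : Fin N → ℝ → ℝ) (p0 : Fin N → ℝ)
    (hHcont : ∀ α, Continuous (H α))
    (hHcoer : ∀ α, ∀ M : ℝ, ∃ R : ℝ, ∀ p : ℝ, R ≤ |p| → M ≤ H α p)
    (hHanti : ∀ α, AntitoneOn (H α) (Iic (p0 α)))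
    (hHmono : ∀ α, MonotoneOn (H α) (Ici (p0 α)))
    (F : (Fin N → ℝ) → ℝ)
    (U : Fin N → ℕ → ℕ → ℝ)
    (hU : IsDiscreteSol H p0 F dx dt U)
    (n : ℕ) (K : ℝ)
    (hK : ∀ α : Fin N, ∀ i : ℕ, K ≤ Wd dt U α i n)
    (b : Fin N → ℝ)
    (hb : ∀ p : Fin N → ℝ, F p ≤ -K → ∀ α, b α ≤ p α) :
    ∀ α : Fin N,
      (∀ i : ℕ, 1 ≤ i →
        piMinus (H α) (p0 α) (-K) ≤ pPlus dx U α i n ∧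
        pPlus dx U α i n ≤ piPlus (H α) (p0 α) (-K)) ∧
      (b α ≤ pPlus dx U α 0 n ∧ pPlus dx U α 0 n ≤ piPlus (H α) (p0 α) (-K)) := by
  obtain ⟨-, h1, h2⟩ := hU
  have key : ∀ α : Fin N, ∀ i : ℕ, 1 ≤ i →
      max (Hp (H α) (p0 α) (pMinus dx U α i n)) (Hm (H α) (p0 α) (pPlus dx U α i n)) ≤ -K := by
    intro α i hi
    have h := hK α i
    unfold Wd at h
    rw [h1 α n i hi, le_div_iff₀ hdt] at h
    nlinarith
  have up : ∀ α : Fin N, ∀ i : ℕ, pPlus dx U α i n ≤ piPlus (H α) (p0 α) (-K) := by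
    intro α i
    apply le_piPlus_aux _ _ _ _ (hHcont α) (hHcoer α)
    exact (le_max_left _ _).trans (key α (i + 1) (by omega))
  intro α
  refine ⟨fun i hi => ⟨?_, up α i⟩, ?_, up α 0⟩
  · apply piMinus_le_aux _ _ _ _ (hHcont α) (hHcoer α)
    exact (le_max_right _ _).trans (key α i hi)
  · refine hb (fun β => pPlus dx U β 0 n) ?_ α
    have h := hK α 0
    unfold Wd at h
    rw [h2 α n, le_div_iff₀ hdt] at h
    nlinarith
end
end

section
/- Monotonicity of the interior scheme operator (Lemma 4.1, interior case). Let H : ℝ → ℝ be L-Lipschitz and nonincreasing on (−∞, p₀], nondecreasing on [p₀, +∞), with monotone envelopes H⁻(p) := H(min(p, p₀)) and H⁺(p) := H(max(p, p₀)). Let Δx, Δt > 0. Define S(a, b, c) := b − Δt·max( H⁺((b − a)/Δx), H⁻((c − b)/Δx) ). Then S is nondecreasing in a and in c; and if moreover L·Δt ≤ Δx, then S is also nondecreasing in b. -/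
open Set

noncomputable section

/-- One-step operator of the explicit scheme at an interior grid point. -/
def Sint (H : ℝ → ℝ) (p0 dx dt : ℝ) (a b c : ℝ) : ℝ :=
  b - dt * max (Hp H p0 ((b - a) / dx)) (Hm H p0 ((c - b) / dx))

/-- Monotonicity of the interior scheme operator (Lemma 4.1, interior case). -/
theorem stmt3 (H : ℝ → ℝ) (p0 : ℝ) (L : NNReal) (hL : LipschitzWith L H)
    (hanti : AntitoneOn H (Iic p0)) (hmono : MonotoneOn H (Ici p0))
    (dx dt : ℝ) (hdx : 0 < dx) (hdt : 0 < dt) :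
    (∀ b c : ℝ, ∀ a a' : ℝ, a ≤ a' → Sint H p0 dx dt a b c ≤ Sint H p0 dx dt a' b c) ∧
    (∀ a b : ℝ, ∀ c c' : ℝ, c ≤ c' → Sint H p0 dx dt a b c ≤ Sint H p0 dx dt a b c') ∧
    ((L : ℝ) * dt ≤ dx →
      ∀ a c : ℝ, ∀ b b' : ℝ, b ≤ b' → Sint H p0 dx dt a b c ≤ Sint H p0 dx dt a b' c) := by
  have hP : ∀ x y : ℝ, x ≤ y → Hp H p0 x ≤ Hp H p0 y := fun x y h =>
    hmono (mem_Ici.2 (le_max_right _ _)) (mem_Ici.2 (le_max_right _ _)) (max_le_max h le_rfl)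
  have hM : ∀ x y : ℝ, x ≤ y → Hm H p0 y ≤ Hm H p0 x := fun x y h =>
    hanti (mem_Iic.2 (min_le_right _ _)) (mem_Iic.2 (min_le_right _ _)) (min_le_min h le_rfl)
  have hLip : ∀ u v d : ℝ, |u - v| ≤ d → H u ≤ H v + L * d := fun u v d h => by
    have h1 := hL.dist_le_mul u v
    rw [Real.dist_eq, Real.dist_eq] at h1
    have h2 := le_abs_self (H u - H v)
    have h3 := mul_le_mul_of_nonneg_left h L.coe_nonneg
    linarith
  refine ⟨fun b c a a' h => ?_, fun a b c c' h => ?_, fun hcfl a c b b' h => ?_⟩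
  · have h1 : (b - a') / dx ≤ (b - a) / dx := by gcongr
    have h2 := mul_le_mul_of_nonneg_left
      (max_le_max (hP _ _ h1) (le_refl (Hm H p0 ((c - b) / dx)))) hdt.le
    unfold Sint
    linarith
  · have h1 : (c - b) / dx ≤ (c' - b) / dx := by gcongr
    have h2 := mul_le_mul_of_nonneg_left
      (max_le_max (le_refl (Hp H p0 ((b - a) / dx))) (hM _ _ h1)) hdt.le
    unfold Sint
    linarith
  · have hd : 0 ≤ (b' - b) / dx := div_nonneg (by linarith) hdx.le
    have e1 : (b' - a) / dx - (b - a) / dx = (b' - b) / dx := by ring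
    have e2 : (c - b') / dx - (c - b) / dx = -((b' - b) / dx) := by ring
    have h1 : Hp H p0 ((b' - a) / dx) ≤ Hp H p0 ((b - a) / dx) + L * ((b' - b) / dx) := by
      apply hLip
      refine (abs_max_sub_max_le_abs _ _ _).trans ?_
      rw [e1, abs_of_nonneg hd]
    have h2 : Hm H p0 ((c - b') / dx) ≤ Hm H p0 ((c - b) / dx) + L * ((b' - b) / dx) := by
      apply hLip
      refine (abs_min_sub_min_le_max _ _ _ _).trans ?_
      rw [e2, abs_neg, abs_of_nonneg hd, sub_self, abs_zero, max_eq_left hd]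
    have h3 : max (Hp H p0 ((b' - a) / dx)) (Hm H p0 ((c - b') / dx)) ≤
        max (Hp H p0 ((b - a) / dx)) (Hm H p0 ((c - b) / dx)) + L * ((b' - b) / dx) :=
      max_le (h1.trans (by gcongr; exact le_max_left _ _))
        (h2.trans (by gcongr; exact le_max_right _ _))
    have h4 := mul_le_mul_of_nonneg_left h3 hdt.le
    have h5 := mul_le_mul_of_nonneg_right hcfl hd
    rw [mul_div_cancel₀ _ hdx.ne'] at h5
    unfold Sint
    linarith
end
end

section
/- Discrete comparison principle (Lemma 4.2). Assume each H_α is L_α-Lipschitz with L_α·Δt ≤ Δx, and F is C¹ with ∂F/∂p_β ≤ 0 everywhere and −∑_β ∂F/∂p_β(p) ≤ Δx/Δt for every p ∈ ℝ^N. Define the scheme operator S^ε on junction-grid families u = (u_i^α) (with u_0^α independent of α) by S^ε[u]_i^α := u_i^α − Δt·max(H_α⁺((u_i^α − u_{i−1}^α)/Δx), H_α⁻((u_{i+1}^α − u_i^α)/Δx)) for i ≥ 1 and S^ε[u]_0 := u_0 − Δt·F(((u_1^β − u_0)/Δx)_β). Let (U_i^{α,n}) and (V_i^{α,n}) be junction-grid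 families (each with branch-independent values at i = 0) such that for all n ≥ 0, U^{n+1} ≤ S^ε[U^n] and V^{n+1} ≥ S^ε[V^n] componentwise. If U_i^{α,0} ≤ V_i^{α,0} for all i and α, then U_i^{α,n} ≤ V_i^{α,n} for all i, α and n. -/
open Set

noncomputable section

/-- The scheme operator `S^ε` on junction-grid families. -/
def Sop {N : ℕ} (H : Fin N → ℝ → ℝ) (p0 : Fin N → ℝ) (F : (Fin N → ℝ) → ℝ)
    (dx dt : ℝ) (u : Fin N → ℕ → ℝ) (α : Fin N) (i : ℕ) : ℝ :=
  if i = 0 then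
    u α 0 - dt * F (fun β => (u β 1 - u β 0) / dx)
  else
    u α i - dt * max (Hp (H α) (p0 α) ((u α i - u α (i - 1)) / dx))
                     (Hm (H α) (p0 α) ((u α (i + 1) - u α i) / dx))

lemma Hp_mono_aux {H : ℝ → ℝ} {p0 : ℝ} (h : MonotoneOn H (Ici p0)) : Monotone (Hp H p0) := by
  intro a b hab
  exact h (mem_Ici.2 (le_max_right _ _)) (mem_Ici.2 (le_max_right _ _)) (max_le_max hab le_rfl)

lemma Hm_anti_aux {H : ℝ → ℝ} {p0 : ℝ} (h : AntitoneOn H (Iic p0)) : Antitone (Hm H p0) := by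
  intro a b hab
  exact h (mem_Iic.2 (min_le_right _ _)) (mem_Iic.2 (min_le_right _ _)) (min_le_min hab le_rfl)

lemma lip_aux {H : ℝ → ℝ} {L : NNReal} (h : LipschitzWith L H) {a b d : ℝ} (hab : |a - b| ≤ d) :
    H a - H b ≤ L * d := by
  have h1 := h.dist_le_mul a b
  rw [Real.dist_eq, Real.dist_eq] at h1
  exact (le_abs_self _).trans (h1.trans (mul_le_mul_of_nonneg_left hab L.2))

lemma Hp_lip_aux {H : ℝ → ℝ} {L : NNReal} (h : LipschitzWith L H) (p0 a b : ℝ) :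
    Hp H p0 a - Hp H p0 b ≤ L * |a - b| :=
  lip_aux h (abs_max_sub_max_le_abs a b p0)

lemma Hm_lip_aux {H : ℝ → ℝ} {L : NNReal} (h : LipschitzWith L H) (p0 a b : ℝ) :
    Hm H p0 a - Hm H p0 b ≤ L * |a - b| :=
  lip_aux h (by simpa using abs_min_sub_min_le_max a p0 b p0)

lemma cfl_aux {L dx dt d : ℝ} (hdx : 0 < dx) (h : L * dt ≤ dx) (hd : 0 ≤ d) :
    dt * (L * (d / dx)) ≤ d := by
  have : dt * (L * (d / dx)) = (L * dt) * d / dx := by ring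
  rw [this, div_le_iff₀ hdx, mul_comm d]
  exact mul_le_mul_of_nonneg_right h hd

lemma Sop_mono_aux {N : ℕ} (dx dt : ℝ) (hdx : 0 < dx) (hdt : 0 < dt)
    (H : Fin N → ℝ → ℝ) (p0 : Fin N → ℝ) (L : Fin N → NNReal)
    (hHL : ∀ α, LipschitzWith (L α) (H α))
    (hCFLH : ∀ α, (L α : ℝ) * dt ≤ dx)
    (hHanti : ∀ α, AntitoneOn (H α) (Iic (p0 α)))
    (hHmono : ∀ α, MonotoneOn (H α) (Ici (p0 α)))
    (F : (Fin N → ℝ) → ℝ)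
    (hFC1 : ContDiff ℝ 1 F)
    (hFdec : ∀ (p : Fin N → ℝ) (β : Fin N), fderiv ℝ F p (Pi.single β 1) ≤ 0)
    (hCFLF : ∀ p : Fin N → ℝ, -∑ β, fderiv ℝ F p (Pi.single β 1) ≤ dx / dt)
    (u v : Fin N → ℕ → ℝ)
    (hu : ∀ α β : Fin N, u α 0 = u β 0) (hv : ∀ α β : Fin N, v α 0 = v β 0)
    (huv : ∀ α i, u α i ≤ v α i) (α : Fin N) (i : ℕ) :
    Sop H p0 F dx dt u α i ≤ Sop H p0 F dx dt v α i := by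
  have hd : 0 ≤ v α i - u α i := sub_nonneg.2 (huv α i)
  unfold Sop
  split_ifs with hi
  · subst hi
    set p : Fin N → ℝ := fun β => (u β 1 - u β 0) / dx with hp
    set q : Fin N → ℝ := fun β => (v β 1 - v β 0) / dx with hq
    obtain ⟨z, -, hz⟩ := domain_mvt (f := F) (s := univ) (x := p) (y := q) (f' := fderiv ℝ F)
      (fun x _ => ((hFC1.differentiable (by simp)) x).hasFDerivAt.hasFDerivWithinAt)
      convex_univ (mem_univ _) (mem_univ _)
    have hexp : fderiv ℝ F z (q - p)
        = ∑ β, (q β - p β) * fderiv ℝ F z (Pi.single β 1) := by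
      conv_lhs => rw [pi_eq_sum_univ' (q - p)]
      rw [map_sum]
      refine Finset.sum_congr rfl fun β _ => ?_
      rw [map_smul, smul_eq_mul]
      congr 2
    have hle : fderiv ℝ F z (q - p) ≤ (v α 0 - u α 0) / dt := by
      rw [hexp]
      calc ∑ β, (q β - p β) * fderiv ℝ F z (Pi.single β 1)
          ≤ ∑ β, (-((v α 0 - u α 0) / dx)) * fderiv ℝ F z (Pi.single β 1) := by
            refine Finset.sum_le_sum fun β _ => mul_le_mul_of_nonpos_right ?_ (hFdec z β)
            simp only [hp, hq]
            rw [← sub_div, ← neg_div]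
            refine div_le_div_of_nonneg_right ?_ hdx.le
            rw [hu α β, hv α β]
            linarith [huv β 1]
        _ = ((v α 0 - u α 0) / dx) * (-∑ β, fderiv ℝ F z (Pi.single β 1)) := by
            rw [← Finset.mul_sum]; ring
        _ ≤ ((v α 0 - u α 0) / dx) * (dx / dt) :=
            mul_le_mul_of_nonneg_left (hCFLF z) (div_nonneg hd hdx.le)
        _ = _ := by field_simp
    rw [← hz, le_div_iff₀ hdt] at hle
    linarith
  · have hL := cfl_aux hdx (hCFLH α) hd
    have hab : |(v α i - u α i) / dx| = (v α i - u α i) / dx := abs_of_nonneg (div_nonneg hd hdx.le)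
    have h1 : dt * Hp (H α) (p0 α) ((v α i - v α (i - 1)) / dx)
        ≤ (v α i - u α i) + dt * Hp (H α) (p0 α) ((u α i - u α (i - 1)) / dx) := by
      have a1 : Hp (H α) (p0 α) ((v α i - v α (i - 1)) / dx)
          ≤ Hp (H α) (p0 α) ((v α i - u α (i - 1)) / dx) :=
        Hp_mono_aux (hHmono α) (div_le_div_of_nonneg_right (by linarith [huv α (i - 1)]) hdx.le)
      have a2 := Hp_lip_aux (hHL α) (p0 α) ((v α i - u α (i - 1)) / dx)
        ((u α i - u α (i - 1)) / dx)
      rw [← sub_div, sub_sub_sub_cancel_right, hab] at a2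
      have a3 := mul_le_mul_of_nonneg_left (add_le_add a1 a2) hdt.le
      linarith
    have h2 : dt * Hm (H α) (p0 α) ((v α (i + 1) - v α i) / dx)
        ≤ (v α i - u α i) + dt * Hm (H α) (p0 α) ((u α (i + 1) - u α i) / dx) := by
      have a1 : Hm (H α) (p0 α) ((v α (i + 1) - v α i) / dx)
          ≤ Hm (H α) (p0 α) ((u α (i + 1) - v α i) / dx) :=
        Hm_anti_aux (hHanti α) (div_le_div_of_nonneg_right (by linarith [huv α (i + 1)]) hdx.le)
      have a2 := Hm_lip_aux (hHL α) (p0 α) ((u α (i + 1) - v α i) / dx)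
        ((u α (i + 1) - u α i) / dx)
      rw [← sub_div, sub_sub_sub_cancel_left, abs_div, abs_sub_comm, ← abs_div, hab] at a2
      have a3 := mul_le_mul_of_nonneg_left (add_le_add a1 a2) hdt.le
      linarith
    rw [mul_max_of_nonneg _ _ hdt.le, mul_max_of_nonneg _ _ hdt.le]
    have h3 := max_le_max h1 h2
    rw [max_add_add_left] at h3
    linarith

/-- Lemma 4.2: discrete comparison principle. -/
theorem stmt5 (N : ℕ) (hN : 1 ≤ N) (dx dt : ℝ) (hdx : 0 < dx) (hdt : 0 < dt)
    (H : Fin N → ℝ → ℝ) (p0 : Fin N → ℝ) (L : Fin N → NNReal)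
    (hHL : ∀ α, LipschitzWith (L α) (H α))
    (hCFLH : ∀ α, (L α : ℝ) * dt ≤ dx)
    (hHanti : ∀ α, AntitoneOn (H α) (Iic (p0 α)))
    (hHmono : ∀ α, MonotoneOn (H α) (Ici (p0 α)))
    (F : (Fin N → ℝ) → ℝ)
    (hFC1 : ContDiff ℝ 1 F)
    (hFdec : ∀ (p : Fin N → ℝ) (β : Fin N), fderiv ℝ F p (Pi.single β 1) ≤ 0)
    (hCFLF : ∀ p : Fin N → ℝ, -∑ β, fderiv ℝ F p (Pi.single β 1) ≤ dx / dt)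
    (U V : ℕ → Fin N → ℕ → ℝ)
    (hU0 : ∀ n : ℕ, ∀ α β : Fin N, U n α 0 = U n β 0)
    (hV0 : ∀ n : ℕ, ∀ α β : Fin N, V n α 0 = V n β 0)
    (hUsub : ∀ n : ℕ, ∀ α : Fin N, ∀ i : ℕ, U (n + 1) α i ≤ Sop H p0 F dx dt (U n) α i)
    (hVsup : ∀ n : ℕ, ∀ α : Fin N, ∀ i : ℕ, V (n + 1) α i ≥ Sop H p0 F dx dt (V n) α i)
    (hinit : ∀ α : Fin N, ∀ i : ℕ, U 0 α i ≤ V 0 α i) :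
    ∀ n : ℕ, ∀ α : Fin N, ∀ i : ℕ, U n α i ≤ V n α i := by
  intro n
  induction n with
  | zero => exact hinit
  | succ n ih =>
    intro α i
    exact (hUsub n α i).trans ((Sop_mono_aux dx dt hdx hdt H p0 L hHL hCFLH hHanti hHmono F hFC1
      hFdec hCFLF (U n) (V n) (hU0 n) (hV0 n) ih α i).trans (hVsup n α i))
end
end

section
/- Stability of the numerical scheme (Lemma 4.4). Assume each H_α is L_α-Lipschitz with L_α·Δt ≤ Δx, and F is C¹ with ∂F/∂p_β ≤ 0 everywhere and −∑_β ∂F/∂p_β(p) ≤ Δx/Δt for every p ∈ ℝ^N. Let u₀^α : [0, ∞) → ℝ (α = 1,…,N) be L₀-Lipschitz functions with u₀^α(0) = u₀^β(0) for all α, β, and let (U_i^{α,n}) be the discrete solution of the junction scheme with initial data U_i^{α,0} = u₀^α(iΔx). Set C₀ := max( max_α sup{ |max(H_α⁺(p), H_α⁻(q))| : |p| ≤ L₀, |q| ≤ L₀ }, sup{ |F(p)| : p ∈ [−L₀, L₀]^N } ). Then for all i ≥ 0, all α and all n ≥ 0: |U_i^{α,n} − u₀^α(iΔx)| ≤ C₀·nΔt.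 -/
open Set

noncomputable section

theorem aux_Hp_le (H : ℝ → ℝ) (p0 : ℝ) (L : NNReal) (hL : LipschitzWith L H)
    (hm : MonotoneOn H (Ici p0)) (a a' e : ℝ) (he : 0 ≤ e) (h : a ≤ a' + e) :
    Hp H p0 a ≤ Hp H p0 a' + L * e := by
  unfold Hp
  have h1 : H (max a p0) ≤ H (max a' p0 + e) := by
    apply hm
    · exact le_max_right a p0
    · exact (le_max_right a' p0).trans (by linarith)
    · apply max_le
      · linarith [le_max_left a' p0]
      · linarith [le_max_right a' p0]
  have h2 := hL.dist_le_mul (max a' p0 + e) (max a' p0)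
  rw [Real.dist_eq, Real.dist_eq, add_sub_cancel_left, abs_of_nonneg he] at h2
  linarith [le_abs_self (H (max a' p0 + e) - H (max a' p0))]

theorem aux_Hm_le (H : ℝ → ℝ) (p0 : ℝ) (L : NNReal) (hL : LipschitzWith L H)
    (hm : AntitoneOn H (Iic p0)) (b b' e : ℝ) (he : 0 ≤ e) (h : b' ≤ b + e) :
    Hm H p0 b ≤ Hm H p0 b' + L * e := by
  unfold Hm
  have h1 : H (min b p0) ≤ H (min b' p0 - e) := by
    apply hm
    · exact (sub_le_self _ he).trans (min_le_right b' p0)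
    · exact min_le_right b p0
    · apply le_min
      · linarith [min_le_left b' p0]
      · linarith [min_le_right b' p0]
  have h2 := hL.dist_le_mul (min b' p0 - e) (min b' p0)
  rw [Real.dist_eq, Real.dist_eq, sub_sub_cancel_left, abs_neg, abs_of_nonneg he] at h2
  linarith [le_abs_self (H (min b' p0 - e) - H (min b' p0))]

theorem aux_G_le (H : ℝ → ℝ) (p0 : ℝ) (L : NNReal) (hL : LipschitzWith L H)
    (hm : AntitoneOn H (Iic p0)) (hM : MonotoneOn H (Ici p0)) (a a' b b' e : ℝ) (he : 0 ≤ e)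
    (ha : a ≤ a' + e) (hb : b' ≤ b + e) :
    max (Hp H p0 a) (Hm H p0 b) ≤ max (Hp H p0 a') (Hm H p0 b') + L * e := by
  apply max_le
  · linarith [aux_Hp_le H p0 L hL hM a a' e he ha, le_max_left (Hp H p0 a') (Hm H p0 b')]
  · linarith [aux_Hm_le H p0 L hL hm b b' e he hb, le_max_right (Hp H p0 a') (Hm H p0 b')]

theorem aux_F_le {N : ℕ} (F : (Fin N → ℝ) → ℝ) (K : ℝ)
    (hFC1 : ContDiff ℝ 1 F)
    (hFdec : ∀ (p : Fin N → ℝ) (β : Fin N), fderiv ℝ F p (Pi.single β 1) ≤ 0)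
    (hCFLF : ∀ p : Fin N → ℝ, -∑ β, fderiv ℝ F p (Pi.single β 1) ≤ K)
    (p q : Fin N → ℝ) (e : ℝ) (he : 0 ≤ e) (h : ∀ β, q β ≤ p β + e) :
    F p ≤ F q + K * e := by
  have hd : Differentiable ℝ F := hFC1.differentiable (by norm_num)
  obtain ⟨z, -, hz⟩ := domain_mvt (f := F) (s := univ) (x := q) (y := p)
    (f' := fun x => fderiv ℝ F x)
    (fun x _ => (hd x).hasFDerivAt.hasFDerivWithinAt) convex_univ (mem_univ _) (mem_univ _)
  have h1 : fderiv ℝ F z (p - q) = ∑ β, (p β - q β) * fderiv ℝ F z (Pi.single β 1) := by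
    conv_lhs => rw [pi_eq_sum_univ' (p - q)]
    simp [map_sum]
  have h2 : ∑ β, (p β - q β) * fderiv ℝ F z (Pi.single β 1)
      ≤ ∑ β, (-e) * fderiv ℝ F z (Pi.single β 1) := by
    apply Finset.sum_le_sum
    intro β _
    exact mul_le_mul_of_nonpos_right (by linarith [h β]) (hFdec z β)
  rw [← Finset.mul_sum] at h2
  have h3 := mul_le_mul_of_nonneg_right (hCFLF z) he
  linarith

theorem aux_step (dx dt K U u M C g G : ℝ) (hdx : 0 < dx) (hdt : 0 < dt) (hK : K * dt ≤ dx)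
    (h : |U - u| ≤ M) (hg : |g| ≤ C)
    (h1 : g ≤ G + K * ((u + M - U) / dx)) (h2 : G ≤ g + K * ((U - (u - M)) / dx)) :
    |U - dt * G - u| ≤ M + C * dt := by
  rw [abs_le] at *
  have key : ∀ d : ℝ, 0 ≤ d → dt * (K * (d / dx)) ≤ d := by
    intro d hd
    have : dt * (K * (d / dx)) = (K * dt) * (d / dx) := by ring
    rw [this]
    calc (K * dt) * (d / dx) ≤ dx * (d / dx) :=
          mul_le_mul_of_nonneg_right hK (div_nonneg hd hdx.le)
      _ = d := by field_simp
  have k1 := key (u + M - U) (by linarith)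
  have k2 := key (U - (u - M)) (by linarith)
  have m1 := mul_le_mul_of_nonneg_left h1 hdt.le
  have m2 := mul_le_mul_of_nonneg_left h2 hdt.le
  have m3 := mul_le_mul_of_nonneg_left hg.1 hdt.le
  have m4 := mul_le_mul_of_nonneg_left hg.2 hdt.le
  constructor <;> linarith

/-- Lemma 4.4: stability of the numerical scheme. -/
theorem stmt6 (N : ℕ) (hN : 1 ≤ N) (dx dt : ℝ) (hdx : 0 < dx) (hdt : 0 < dt)
    (H : Fin N → ℝ → ℝ) (p0 : Fin N → ℝ) (L : Fin N → NNReal)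
    (hHL : ∀ α, LipschitzWith (L α) (H α))
    (hCFLH : ∀ α, (L α : ℝ) * dt ≤ dx)
    (hHanti : ∀ α, AntitoneOn (H α) (Iic (p0 α)))
    (hHmono : ∀ α, MonotoneOn (H α) (Ici (p0 α)))
    (F : (Fin N → ℝ) → ℝ)
    (hFC1 : ContDiff ℝ 1 F)
    (hFdec : ∀ (p : Fin N → ℝ) (β : Fin N), fderiv ℝ F p (Pi.single β 1) ≤ 0)
    (hCFLF : ∀ p : Fin N → ℝ, -∑ β, fderiv ℝ F p (Pi.single β 1) ≤ dx / dt)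
    (L0 : NNReal) (u0 : Fin N → ℝ → ℝ)
    (hu0L : ∀ α, LipschitzOnWith L0 (u0 α) (Ici 0))
    (hu00 : ∀ α β : Fin N, u0 α 0 = u0 β 0)
    (U : Fin N → ℕ → ℕ → ℝ)
    (hU : IsDiscreteSol H p0 F dx dt U)
    (hUinit : ∀ α : Fin N, ∀ i : ℕ, U α i 0 = u0 α (i * dx)) :
    ∀ α : Fin N, ∀ i n : ℕ,
      |U α i n - u0 α (i * dx)| ≤
        max
          (sSup {x : ℝ | ∃ (α : Fin N) (p q : ℝ), |p| ≤ (L0 : ℝ) ∧ |q| ≤ (L0 : ℝ) ∧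
            x = |max (Hp (H α) (p0 α) p) (Hm (H α) (p0 α) q)|})
          (sSup {x : ℝ | ∃ p : Fin N → ℝ, (∀ β, |p β| ≤ (L0 : ℝ)) ∧ x = |F p|})
        * (n * dt) := by
  obtain ⟨hU0, hUi, hUj⟩ := hU
  set S1 := {x : ℝ | ∃ (α : Fin N) (p q : ℝ), |p| ≤ (L0 : ℝ) ∧ |q| ≤ (L0 : ℝ) ∧
            x = |max (Hp (H α) (p0 α) p) (Hm (H α) (p0 α) q)|} with hS1
  set S2 := {x : ℝ | ∃ p : Fin N → ℝ, (∀ β, |p β| ≤ (L0 : ℝ)) ∧ x = |F p|} with hS2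
  have b1 : BddAbove S1 := by
    have : S1 ⊆ ⋃ α ∈ (univ : Set (Fin N)),
        (fun z : ℝ × ℝ => |max (Hp (H α) (p0 α) z.1) (Hm (H α) (p0 α) z.2)|) ''
          (Icc (-(L0 : ℝ)) L0 ×ˢ Icc (-(L0 : ℝ)) L0) := by
      rintro x ⟨α, p, q, hp, hq, rfl⟩
      simp only [mem_iUnion]
      exact ⟨α, mem_univ _, (p, q), ⟨abs_le.1 hp, abs_le.1 hq⟩, rfl⟩
    refine BddAbove.mono this ((Set.finite_univ.bddAbove_biUnion).2 ?_)
    intro α _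
    apply IsCompact.bddAbove
    apply (isCompact_Icc.prod isCompact_Icc).image
    have := (hHL α).continuous
    unfold Hp Hm
    fun_prop
  have b2 : BddAbove S2 := by
    have : S2 ⊆ (fun p => |F p|) '' (Icc (fun _ => -(L0 : ℝ)) (fun _ => (L0 : ℝ))) := by
      rintro x ⟨p, hp, rfl⟩
      exact ⟨p, ⟨fun β => (abs_le.1 (hp β)).1, fun β => (abs_le.1 (hp β)).2⟩, rfl⟩
    refine BddAbove.mono this (IsCompact.bddAbove (isCompact_Icc.image ?_))
    exact hFC1.continuous.abs
  set C := max (sSup S1) (sSup S2) with hC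
  have c1 : ∀ α p q, |p| ≤ (L0 : ℝ) → |q| ≤ (L0 : ℝ) →
      |max (Hp (H α) (p0 α) p) (Hm (H α) (p0 α) q)| ≤ C := fun α p q hp hq =>
    (le_csSup b1 ⟨α, p, q, hp, hq, rfl⟩).trans (le_max_left _ _)
  have c2 : ∀ p : Fin N → ℝ, (∀ β, |p β| ≤ (L0 : ℝ)) → |F p| ≤ C := fun p hp =>
    (le_csSup b2 ⟨p, hp, rfl⟩).trans (le_max_right _ _)
  have hgrad : ∀ (α : Fin N) (i : ℕ),
      |(u0 α (((i + 1 : ℕ) : ℝ) * dx) - u0 α (i * dx)) / dx| ≤ L0 := by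
    intro α i
    have := (hu0L α).dist_le_mul (((i + 1 : ℕ) : ℝ) * dx) (mem_Ici.2 (by positivity))
      ((i : ℝ) * dx) (mem_Ici.2 (by positivity))
    rw [Real.dist_eq, Real.dist_eq] at this
    rw [abs_div, abs_of_pos hdx, div_le_iff₀ hdx]
    have e : |((i + 1 : ℕ) : ℝ) * dx - (i : ℝ) * dx| = dx := by
      push_cast
      rw [show ((i : ℝ) + 1) * dx - i * dx = dx by ring, abs_of_pos hdx]
    rwa [e] at this
  have cmp : ∀ a b c d : ℝ, a - b ≤ c - d → a / dx ≤ b / dx + (c - d) / dx := by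
    intro a b c d h
    rw [← add_div]
    exact div_le_div_of_nonneg_right (by linarith) hdx.le
  intro α i n
  induction n generalizing α i with
  | zero => simp [hUinit]
  | succ n ih =>
    have ih' := fun α i => abs_le.1 (ih α i)
    have eM : C * (((n + 1 : ℕ) : ℝ) * dt) = C * (n * dt) + C * dt := by push_cast; ring
    rw [eM]
    generalize C * (n * dt) = M at ih ih'
    rcases i with _ | k
    · rw [hUj]
      refine aux_step dx dt (dx / dt) _ _ M C
        (F (fun β => (u0 β (((0 + 1 : ℕ) : ℝ) * dx) - u0 β ((0 : ℕ) * dx)) / dx)) _ hdx hdt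
        (by rw [div_mul_cancel₀ _ hdt.ne']) (ih α 0) (c2 _ fun β => hgrad β 0) ?_ ?_
      · refine aux_F_le F _ hFC1 hFdec hCFLF _ _ _
          (div_nonneg (by linarith [(ih' α 0).2]) hdx.le) fun β => ?_
        unfold pPlus
        apply cmp
        have h0 : u0 β ((0 : ℕ) * dx) = u0 α ((0 : ℕ) * dx) := by simpa using hu00 β α
        linarith [hU0 α β n, (ih' β (0+1)).2]
      · refine aux_F_le F _ hFC1 hFdec hCFLF _ _ _
          (div_nonneg (by linarith [(ih' α 0).1]) hdx.le) fun β => ?_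
        unfold pPlus
        apply cmp
        have h0 : u0 β ((0 : ℕ) * dx) = u0 α ((0 : ℕ) * dx) := by simpa using hu00 β α
        linarith [hU0 α β n, (ih' β (0+1)).1]
    · rw [hUi α n (k+1) (by omega)]
      refine aux_step dx dt (L α) _ _ M C _ _ hdx hdt
        (hCFLH α) (ih α (k+1)) (c1 α _ _ (hgrad α k) (hgrad α (k+1))) ?_ ?_
      · refine aux_G_le (H α) (p0 α) (L α) (hHL α) (hHanti α) (hHmono α) _ _ _ _ _
          (div_nonneg (by linarith [(ih' α (k+1)).2]) hdx.le) ?_ ?_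
        · unfold pMinus
          apply cmp
          rw [Nat.add_sub_cancel]
          linarith [(ih' α k).2]
        · unfold pPlus
          apply cmp
          linarith [(ih' α (k+1+1)).2]
      · refine aux_G_le (H α) (p0 α) (L α) (hHL α) (hHanti α) (hHmono α) _ _ _ _ _
          (div_nonneg (by linarith [(ih' α (k+1)).1]) hdx.le) ?_ ?_
        · unfold pMinus
          apply cmp
          rw [Nat.add_sub_cancel]
          linarith [(ih' α k).1]
        · unfold pPlus
          apply cmp
          linarith [(ih' α (k+1+1)).1]
end
end

section
/- Consistency of the numerical Hamiltonian (Lemma 4.5, branch version). Let H : ℝ → ℝ be continuous, nonincreasing on (−∞, p₀] and nondecreasing on [p₀, +∞), with monotone envelopes H⁻(p) := H(min(p, p₀)) and H⁺(p) := H(max(p, p₀)). Then H(p) = max(H⁺(p), H⁻(p)) for every p ∈ ℝ; and for every function φ : ℝ → ℝ that is continuously differentiable on a neighborhood of a point x, and all sequences (y_k) and (Δx_k) with y_k → x, Δx_k > 0 and Δx_k → 0, one has max( H⁺((φ(y_k) − φ(y_k − Δx_k))/Δx_k), H⁻((φ(y_k + Δx_k) − φ(y_k))/Δx_k) ) → H(φ'(x))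 as k → ∞. -/
open Set Filter Topology

noncomputable section

lemma aux_quot (φ : ℝ → ℝ) (x d : ℝ) (h : HasStrictDerivAt φ d x) (a b dx : ℕ → ℝ)
    (ha : Tendsto a atTop (𝓝 x)) (hb : Tendsto b atTop (𝓝 x)) (hdx : ∀ k, 0 < dx k)
    (hab : ∀ k, a k - b k = dx k) :
    Tendsto (fun k => (φ (a k) - φ (b k)) / dx k) atTop (𝓝 d) := by
  have h1 := (hasStrictDerivAt_iff_hasStrictFDerivAt.1 h).isLittleO
  have h2 := h1.comp_tendsto (ha.prodMk_nhds hb)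
  have h3 := h2.tendsto_div_nhds_zero
  have h4 := h3.add_const d
  rw [zero_add] at h4
  refine h4.congr fun k => ?_
  have := (hdx k).ne'
  simp only [Function.comp, hab, ContinuousLinearMap.toSpanSingleton_apply, smul_eq_mul]
  field_simp
  ring

/-- Lemma 4.5 (branch version): consistency of the numerical Hamiltonian. -/
theorem stmt7 (H : ℝ → ℝ) (p0 : ℝ)
    (hHcont : Continuous H)
    (hHanti : AntitoneOn H (Iic p0))
    (hHmono : MonotoneOn H (Ici p0)) :
    (∀ p : ℝ, H p = max (Hp H p0 p) (Hm H p0 p)) ∧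
    (∀ (φ : ℝ → ℝ) (x : ℝ), ContDiffAt ℝ 1 φ x →
      ∀ (y : ℕ → ℝ) (dx : ℕ → ℝ),
        Tendsto y atTop (𝓝 x) → (∀ k, 0 < dx k) → Tendsto dx atTop (𝓝 0) →
        Tendsto
          (fun k =>
            max (Hp H p0 ((φ (y k) - φ (y k - dx k)) / dx k))
                (Hm H p0 ((φ (y k + dx k) - φ (y k)) / dx k)))
          atTop (𝓝 (H (deriv φ x)))) := by
  have key : ∀ p : ℝ, H p = max (Hp H p0 p) (Hm H p0 p) := by
    intro p
    unfold Hp Hm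
    rcases le_total p p0 with h | h
    · rw [max_eq_right h, min_eq_left h, max_eq_right]
      exact hHanti h (mem_Iic.2 le_rfl) h
    · rw [max_eq_left h, min_eq_right h, max_eq_left]
      exact hHmono (mem_Ici.2 le_rfl) h h
  refine ⟨key, ?_⟩
  intro φ x hφ y dx hy hpos hdx
  have hs := hφ.hasStrictDerivAt one_ne_zero
  have h1 := aux_quot φ x _ hs y (fun k => y k - dx k) dx hy
    (by simpa using hy.sub hdx) hpos (fun k => by ring)
  have h2 := aux_quot φ x _ hs (fun k => y k + dx k) y dx
    (by simpa using hy.add hdx) hy hpos (fun k => by ring)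
  rw [key (deriv φ x)]
  have c1 : Continuous (Hp H p0) := hHcont.comp (continuous_id.max continuous_const)
  have c2 : Continuous (Hm H p0) := hHcont.comp (continuous_id.min continuous_const)
  exact ((c1.tendsto _).comp h1).max ((c2.tendsto _).comp h2)
end
end

section
/- Discrete viscosity inequality at a maximum point (Lemma 4.3, subsolution case). Let A ∈ ℝ and let the junction function be F_A(p) := max(A, max_α H_α⁻(p_α)). Assume each H_α is L_α-Lipschitz with L_α·Δt ≤ Δx, and let (U_i^{α,n}) be a discrete solution of the junction scheme with F = F_A. Let φ be a test function on the junction, given by functions φ^α : ℝ × ℝ → ℝ with φ^α(t, 0) = φ^β(t, 0) for all t and all α, β. Suppose there exist n̄ ∈ ℕ, ī ∈ ℕ and ᾱ such that for all n ∈ ℕ, i ∈ ℕ and α: U_i^{α,n} − φ^α(nΔt, iΔx) ≤ U_ī^{ᾱ,n̄+1} − φ^ᾱ((n̄+1)Δt, īΔx). Set t̄ := n̄Δt and x̄ := īΔx. Then: if ī ≥ 1, (φ^ᾱ(t̄+Δt, x̄) − φ^ᾱ(t̄, x̄))/Δt + max( H_ᾱ⁺((φ^ᾱ(t̄, x̄)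 − φ^ᾱ(t̄, x̄−Δx))/Δx), H_ᾱ⁻((φ^ᾱ(t̄, x̄+Δx) − φ^ᾱ(t̄, x̄))/Δx) ) ≤ 0; and if ī = 0, (φ^ᾱ(t̄+Δt, 0) − φ^ᾱ(t̄, 0))/Δt + max( A, max_β H_β⁻((φ^β(t̄, Δx) − φ^β(t̄, 0))/Δx) ) ≤ 0. -/
open Set

noncomputable section

/-- The A-limited flux junction function `F_A(p) = max(A, max_α H_α⁻(p_α))`. -/
def FA {N : ℕ} (H : Fin N → ℝ → ℝ) (p0 : Fin N → ℝ) (A : ℝ) (p : Fin N → ℝ) : ℝ :=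
  max A (⨆ α, Hm (H α) (p0 α) (p α))

theorem aux_lip_s8 (H : ℝ → ℝ) (L : NNReal) (hL : LipschitzWith L H) (x y e : ℝ)
    (h : |x - y| = e) : H x ≤ H y + L * e := by
  have h1 := hL.dist_le_mul x y
  rw [Real.dist_eq, Real.dist_eq, h] at h1
  have := le_abs_self (H x - H y)
  linarith

theorem aux_p (H : ℝ → ℝ) (p0 : ℝ) (L : NNReal) (hL : LipschitzWith L H)
    (hm : MonotoneOn H (Ici p0)) (q q' e : ℝ) (he : 0 ≤ e) (h : q' ≤ q + e) :
    Hp H p0 q' ≤ Hp H p0 q + L * e := by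
  unfold Hp
  have h0 : p0 ≤ max q' p0 := le_max_right _ _
  have h1 : max q' p0 ≤ max q p0 + e :=
    max_le (h.trans (by linarith [le_max_left q p0])) (by linarith [le_max_right q p0])
  refine (hm h0 (h0.trans h1) h1).trans (aux_lip_s8 H L hL _ _ e ?_)
  rw [add_sub_cancel_left, abs_of_nonneg he]

theorem aux_m (H : ℝ → ℝ) (p0 : ℝ) (L : NNReal) (hL : LipschitzWith L H)
    (hm : AntitoneOn H (Iic p0)) (q q' e : ℝ) (he : 0 ≤ e) (h : q - e ≤ q') :
    Hm H p0 q' ≤ Hm H p0 q + L * e := by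
  unfold Hm
  have h0 : min q' p0 ≤ p0 := min_le_right _ _
  have h1 : min q p0 - e ≤ min q' p0 :=
    le_min (by linarith [min_le_left q p0]) (by linarith [min_le_right q p0])
  refine (hm (h1.trans h0) h0 h1).trans (aux_lip_s8 H L hL _ _ e ?_)
  rw [sub_sub_cancel_left, abs_neg, abs_of_nonneg he]

theorem aux_cfl (L dx dt d : ℝ) (hdx : 0 < dx) (hc : L * dt ≤ dx) (hd : 0 ≤ d) :
    dt * (L * (d / dx)) ≤ d := by
  have : dt * (L * (d / dx)) = (L * dt) * d / dx := by ring
  rw [this, div_le_iff₀ hdx]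
  nlinarith

/-- Lemma 4.3 (subsolution case): discrete viscosity inequality at a maximum point. -/
theorem stmt8 (N : ℕ) (hN : 1 ≤ N) (dx dt : ℝ) (hdx : 0 < dx) (hdt : 0 < dt)
    (H : Fin N → ℝ → ℝ) (p0 : Fin N → ℝ) (L : Fin N → NNReal)
    (hHL : ∀ α, LipschitzWith (L α) (H α))
    (hCFLH : ∀ α, (L α : ℝ) * dt ≤ dx)
    (hHanti : ∀ α, AntitoneOn (H α) (Iic (p0 α)))
    (hHmono : ∀ α, MonotoneOn (H α) (Ici (p0 α)))
    (A : ℝ)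
    (U : Fin N → ℕ → ℕ → ℝ)
    (hU : IsDiscreteSol H p0 (FA H p0 A) dx dt U)
    (φ : Fin N → ℝ → ℝ → ℝ)
    (hφ0 : ∀ t : ℝ, ∀ α β : Fin N, φ α t 0 = φ β t 0)
    (nb ib : ℕ) (ab : Fin N)
    (hmax : ∀ (n i : ℕ) (α : Fin N),
      U α i n - φ α (n * dt) (i * dx) ≤
        U ab ib (nb + 1) - φ ab ((nb + 1 : ℕ) * dt) (ib * dx)) :
    (1 ≤ ib →
      (φ ab ((nb : ℝ) * dt + dt) ((ib : ℝ) * dx) - φ ab ((nb : ℝ) * dt) ((ib : ℝ) * dx)) / dt +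
        max (Hp (H ab) (p0 ab)
              ((φ ab ((nb : ℝ) * dt) ((ib : ℝ) * dx)
                - φ ab ((nb : ℝ) * dt) ((ib : ℝ) * dx - dx)) / dx))
            (Hm (H ab) (p0 ab)
              ((φ ab ((nb : ℝ) * dt) ((ib : ℝ) * dx + dx)
                - φ ab ((nb : ℝ) * dt) ((ib : ℝ) * dx)) / dx)) ≤ 0) ∧
    (ib = 0 →
      (φ ab ((nb : ℝ) * dt + dt) 0 - φ ab ((nb : ℝ) * dt) 0) / dt +
        max A (⨆ β, Hm (H β) (p0 β)
          ((φ β ((nb : ℝ) * dt) dx - φ β ((nb : ℝ) * dt) 0) / dx)) ≤ 0) := by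
  obtain ⟨hU0, hU1, hU2⟩ := hU
  have ht : ((nb + 1 : ℕ) : ℝ) * dt = (nb : ℝ) * dt + dt := by push_cast; ring
  rw [ht] at hmax
  -- final step
  have fin : ∀ a b G : ℝ, a - b + dt * G ≤ 0 → (a - b) / dt + G ≤ 0 := by
    intro a b G h
    have : (a - b) / dt + G = (a - b + dt * G) / dt := by field_simp
    rw [this]
    exact div_nonpos_of_nonpos_of_nonneg h hdt.le
  constructor
  · intro hib
    apply fin
    obtain ⟨j, rfl⟩ : ∃ j, ib = j + 1 := ⟨ib - 1, by omega⟩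
    have e1 : ((j + 1 : ℕ) : ℝ) * dx - dx = (j : ℝ) * dx := by push_cast; ring
    have e2 : ((j + 1 : ℕ) : ℝ) * dx + dx = ((j + 1 + 1 : ℕ) : ℝ) * dx := by push_cast; ring
    rw [e1, e2]
    have m0 := hmax nb j ab
    have m1 := hmax nb (j + 1) ab
    have m2 := hmax nb (j + 1 + 1) ab
    have s := hU1 ab nb (j + 1) hib
    simp only [pMinus, pPlus, Nat.add_sub_cancel] at s
    set K := U ab (j + 1) (nb + 1) - φ ab (nb * dt + dt) ((j + 1 : ℕ) * dx) with hK
    set a := φ ab (nb * dt) ((j : ℕ) * dx)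
    set b := φ ab (nb * dt) ((j + 1 : ℕ) * dx)
    set c := φ ab (nb * dt) ((j + 1 + 1 : ℕ) * dx)
    set d := b + K - U ab (j + 1) nb with hd
    have d0 : 0 ≤ d := by linarith
    have hc := aux_cfl (L ab) dx dt d hdx (hCFLH ab) d0
    have k1 := aux_p (H ab) (p0 ab) (L ab) (hHL ab) (hHmono ab)
      ((U ab (j + 1) nb - U ab j nb) / dx) ((b - a) / dx) (d / dx) (by positivity)
      (by rw [← add_div]; exact div_le_div_of_nonneg_right (by linarith) hdx.le)
    have k2 := aux_m (H ab) (p0 ab) (L ab) (hHL ab) (hHanti ab)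
      ((U ab (j + 1 + 1) nb - U ab (j + 1) nb) / dx) ((c - b) / dx) (d / dx) (by positivity)
      (by rw [← sub_div]; exact div_le_div_of_nonneg_right (by linarith) hdx.le)
    have k3 := max_le_max k1 k2
    rw [max_add_add_right] at k3
    have k4 := mul_le_mul_of_nonneg_left k3 hdt.le
    rw [mul_add] at k4
    linarith
  · rintro rfl
    apply fin
    have : Nonempty (Fin N) := ⟨ab⟩
    simp only [Nat.cast_zero, zero_mul] at hmax
    have m0 := hmax nb 0 ab
    simp only [Nat.cast_zero, zero_mul] at m0
    have s := hU2 ab nb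
    simp only [FA, pPlus, zero_add] at s
    set K := U ab 0 (nb + 1) - φ ab (nb * dt + dt) 0 with hK
    set b := φ ab (nb * dt) 0 with hb
    set d := b + K - U ab 0 nb with hd
    have d0 : 0 ≤ d := by linarith
    set M := max A (⨆ β, Hm (H β) (p0 β) ((U β 1 nb - U β 0 nb) / dx)) with hM
    have key : max A (⨆ β, Hm (H β) (p0 β)
        ((φ β (nb * dt) dx - φ β (nb * dt) 0) / dx)) ≤ M + d / dt := by
      have hdd : 0 ≤ d / dt := by positivity
      refine max_le ((le_max_left A _).trans (le_add_of_nonneg_right hdd)) (ciSup_le fun β => ?_)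
      have m1 := hmax nb 1 β
      simp only [Nat.cast_one, one_mul] at m1
      have hu := hU0 β ab nb
      have hp := hφ0 (nb * dt) β ab
      have hc := aux_cfl (L β) dx dt d hdx (hCFLH β) d0
      have k2 := aux_m (H β) (p0 β) (L β) (hHL β) (hHanti β)
        ((U β 1 nb - U β 0 nb) / dx) ((φ β (nb * dt) dx - φ β (nb * dt) 0) / dx) (d / dx)
        (by positivity) (by rw [← sub_div]; exact div_le_div_of_nonneg_right (by linarith) hdx.le)
      have k3 := le_ciSup (f := fun β => Hm (H β) (p0 β) ((U β 1 nb - U β 0 nb) / dx))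
        (Set.finite_range _).bddAbove β
      have k4 := (k3.trans (le_max_right A _))
      have k5 : (L β : ℝ) * (d / dx) ≤ d / dt := by
        rw [le_div_iff₀ hdt]; linarith
      linarith
    have k4 := mul_le_mul_of_nonneg_left key hdt.le
    rw [mul_add, mul_div_cancel₀ _ hdt.ne'] at k4
    linarith
end
end

section
/- Discrete viscosity inequality at a minimum point (Lemma 4.3, supersolution case). Let A ∈ ℝ and let the junction function be F_A(p) := max(A, max_α H_α⁻(p_α)). Assume each H_α is L_α-Lipschitz with L_α·Δt ≤ Δx, and let (U_i^{α,n}) be a discrete solution of the junction scheme with F = F_A. Let φ be a test function on the junction, given by functions φ^α : ℝ × ℝ → ℝ with φ^α(t, 0) = φ^β(t, 0) for all t and all α, β. Suppose there exist n̄ ∈ ℕ, ī ∈ ℕ and ᾱ such that for all n ∈ ℕ, i ∈ ℕ and α: U_i^{α,n} − φ^α(nΔt, iΔx) ≥ U_ī^{ᾱ,n̄+1} − φ^ᾱ((n̄+1)Δt, īΔx). Set t̄ := n̄Δt and x̄ := īΔx. Then: if ī ≥ 1, (φ^ᾱ(t̄+Δt, x̄) − φ^ᾱ(t̄, x̄))/Δt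 + max( H_ᾱ⁺((φ^ᾱ(t̄, x̄) − φ^ᾱ(t̄, x̄−Δx))/Δx), H_ᾱ⁻((φ^ᾱ(t̄, x̄+Δx) − φ^ᾱ(t̄, x̄))/Δx) ) ≥ 0; and if ī = 0, (φ^ᾱ(t̄+Δt, 0) − φ^ᾱ(t̄, 0))/Δt + max( A, max_β H_β⁻((φ^β(t̄, Δx) − φ^β(t̄, 0))/Δx) ) ≥ 0. -/
open Set

noncomputable section

theorem cfl_aux_s9 (L : NNReal) (dx dt d x y s : ℝ) (f : ℝ → ℝ) (hf : LipschitzWith L f)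
    (hdx : 0 < dx) (hdt : 0 < dt) (hc : (L : ℝ) * dt ≤ dx) (hd : 0 ≤ d)
    (hs : s ≤ d / dx) (hxy : |x - y| ≤ s) : f x ≤ f y + d / dt := by
  have h1 := hf.dist_le_mul x y
  rw [Real.dist_eq, Real.dist_eq] at h1
  have h2 := le_abs_self (f x - f y)
  have h3 : (L : ℝ) * |x - y| ≤ L * (d / dx) :=
    mul_le_mul_of_nonneg_left (hxy.trans hs) L.2
  have h4 : (L : ℝ) * (d / dx) ≤ d / dt := by
    rw [← mul_div_assoc, div_le_div_iff₀ hdx hdt]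
    nlinarith
  linarith

theorem Hm_aux (L : NNReal) (dx dt d a b p : ℝ) (f : ℝ → ℝ) (hf : LipschitzWith L f)
    (hdx : 0 < dx) (hdt : 0 < dt) (hc : (L : ℝ) * dt ≤ dx) (hd : 0 ≤ d)
    (hm : AntitoneOn f (Iic p)) (hab : a - b ≤ d / dx) : Hm f p b ≤ Hm f p a + d / dt := by
  unfold Hm
  rcases le_total a b with h | h
  · have := hm (Set.mem_Iic.2 (min_le_right _ _))
      (Set.mem_Iic.2 (min_le_right _ _)) (min_le_min_right p h)
    have : 0 ≤ d / dt := by positivity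
    linarith
  · refine cfl_aux_s9 L dx dt d _ _ (a - b) f hf hdx hdt hc hd hab ?_
    have := abs_min_sub_min_le_max b p a p
    rw [sub_self, abs_zero, max_eq_left (abs_nonneg _), abs_of_nonpos (by linarith : b - a ≤ 0)]
      at this
    linarith

theorem Hp_aux (L : NNReal) (dx dt d a b p : ℝ) (f : ℝ → ℝ) (hf : LipschitzWith L f)
    (hdx : 0 < dx) (hdt : 0 < dt) (hc : (L : ℝ) * dt ≤ dx) (hd : 0 ≤ d)
    (hm : MonotoneOn f (Ici p)) (hab : b - a ≤ d / dx) : Hp f p b ≤ Hp f p a + d / dt := by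
  unfold Hp
  rcases le_total b a with h | h
  · have := hm (Set.mem_Ici.2 (le_max_right _ _))
      (Set.mem_Ici.2 (le_max_right _ _)) (max_le_max_right p h)
    have : 0 ≤ d / dt := by positivity
    linarith
  · refine cfl_aux_s9 L dx dt d _ _ (b - a) f hf hdx hdt hc hd hab ?_
    have := abs_max_sub_max_le_max b p a p
    rw [sub_self, abs_zero, max_eq_left (abs_nonneg (b - a)), abs_of_nonneg (by linarith : 0 ≤ b - a)]
      at this
    linarith

/-- Lemma 4.3 (supersolution case): discrete viscosity inequality at a minimum point. -/
theorem stmt9 (N : ℕ) (hN : 1 ≤ N) (dx dt : ℝ) (hdx : 0 < dx) (hdt : 0 < dt)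
    (H : Fin N → ℝ → ℝ) (p0 : Fin N → ℝ) (L : Fin N → NNReal)
    (hHL : ∀ α, LipschitzWith (L α) (H α))
    (hCFLH : ∀ α, (L α : ℝ) * dt ≤ dx)
    (hHanti : ∀ α, AntitoneOn (H α) (Iic (p0 α)))
    (hHmono : ∀ α, MonotoneOn (H α) (Ici (p0 α)))
    (A : ℝ)
    (U : Fin N → ℕ → ℕ → ℝ)
    (hU : IsDiscreteSol H p0 (FA H p0 A) dx dt U)
    (φ : Fin N → ℝ → ℝ → ℝ)
    (hφ0 : ∀ t : ℝ, ∀ α β : Fin N, φ α t 0 = φ β t 0)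
    (nb ib : ℕ) (ab : Fin N)
    (hmax : ∀ (n i : ℕ) (α : Fin N),
      U α i n - φ α (n * dt) (i * dx) ≥
        U ab ib (nb + 1) - φ ab ((nb + 1 : ℕ) * dt) (ib * dx)) :
    (1 ≤ ib →
      (φ ab ((nb : ℝ) * dt + dt) ((ib : ℝ) * dx) - φ ab ((nb : ℝ) * dt) ((ib : ℝ) * dx)) / dt +
        max (Hp (H ab) (p0 ab)
              ((φ ab ((nb : ℝ) * dt) ((ib : ℝ) * dx)
                - φ ab ((nb : ℝ) * dt) ((ib : ℝ) * dx - dx)) / dx))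
            (Hm (H ab) (p0 ab)
              ((φ ab ((nb : ℝ) * dt) ((ib : ℝ) * dx + dx)
                - φ ab ((nb : ℝ) * dt) ((ib : ℝ) * dx)) / dx)) ≥ 0) ∧
    (ib = 0 →
      (φ ab ((nb : ℝ) * dt + dt) 0 - φ ab ((nb : ℝ) * dt) 0) / dt +
        max A (⨆ β, Hm (H β) (p0 β)
          ((φ β ((nb : ℝ) * dt) dx - φ β ((nb : ℝ) * dt) 0) / dx)) ≥ 0) := by
  obtain ⟨hU0, hU1, hU2⟩ := hU
  have e1 : (((nb + 1 : ℕ) : ℝ)) * dt = (nb : ℝ) * dt + dt := by push_cast; ring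
  rw [e1] at hmax
  have fin : ∀ u u' f f' m G K d : ℝ, u' = u - dt * G → m = u' - f' → d = u - f - m →
      G ≤ K + d / dt → (f' - f) / dt + K ≥ 0 := by
    intro u u' f f' m G K d h1 h2 h3 h4
    have h5 : (f' - f) / dt = d / dt - G := by
      rw [div_eq_iff hdt.ne', sub_mul, div_mul_cancel₀ _ hdt.ne']
      linarith
    linarith
  constructor
  · intro hi
    have h0 := hmax nb ib ab
    have hp := hmax nb (ib + 1) ab
    have hm := hmax nb (ib - 1) ab
    have e2 : ((ib + 1 : ℕ) : ℝ) * dx = (ib : ℝ) * dx + dx := by push_cast; ring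
    have e3 : ((ib - 1 : ℕ) : ℝ) * dx = (ib : ℝ) * dx - dx := by
      rw [Nat.cast_sub hi]; push_cast; ring
    rw [e2] at hp
    rw [e3] at hm
    refine fin _ _ _ _ _ _ _ _ (hU1 ab nb ib hi) rfl rfl ?_
    rw [← max_add_add_right]
    apply max_le_max
    · apply Hp_aux (L ab) dx dt _ _ _ _ _ (hHL ab) hdx hdt (hCFLH ab) _ (hHmono ab)
      · unfold pMinus
        rw [← sub_div]
        apply div_le_div_of_nonneg_right _ hdx.le
        linarith
      · linarith
    · apply Hm_aux (L ab) dx dt _ _ _ _ _ (hHL ab) hdx hdt (hCFLH ab) _ (hHanti ab)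
      · unfold pPlus
        rw [← sub_div]
        apply div_le_div_of_nonneg_right _ hdx.le
        linarith
      · linarith
  · intro hi
    subst hi
    have h0 := hmax nb 0 ab
    have hp := fun β => hmax nb (0 + 1) β
    simp only [Nat.cast_zero, zero_mul, zero_add, Nat.cast_one, one_mul] at h0 hp
    refine fin _ _ _ _ _ _ _ _ (hU2 ab nb) rfl rfl ?_
    have hd : 0 ≤ U ab 0 nb - φ ab (nb * dt) 0
        - (U ab 0 (nb + 1) - φ ab (nb * dt + dt) 0) := by linarith
    unfold FA
    rw [← max_add_add_right]
    apply max_le_max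
    · have := div_nonneg hd hdt.le
      linarith
    · have : Nonempty (Fin N) := ⟨ab⟩
      apply ciSup_le
      intro β
      refine le_trans (Hm_aux (L β) dx dt _ _ _ _ _ (hHL β) hdx hdt (hCFLH β) hd (hHanti β) ?_)
        (add_le_add_left (le_ciSup (f := fun β => Hm (H β) (p0 β)
          ((φ β ((nb : ℝ) * dt) dx - φ β ((nb : ℝ) * dt) 0) / dx))
          (Set.finite_range _).bddAbove β) _)
      unfold pPlus
      rw [← sub_div]
      apply div_le_div_of_nonneg_right _ hdx.le
      have := hp β
      have := hU0 β ab nb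
      have := hφ0 (nb * dt) β ab
      simp only [zero_add]
      linarith
end
end

section
/- Reduction of the BLN boundary condition for quasiconvex fluxes (Appendix A). Let H : ℝ → ℝ be continuous, nonincreasing on (−∞, p₀] and nondecreasing on [p₀, +∞), with monotone envelopes H⁻(p) := H(min(p, p₀)) and H⁺(p) := H(max(p, p₀)). Then for all v_τ, v_b ∈ ℝ, the BLN condition 'for every κ ∈ [min(v_b, v_τ), max(v_b, v_τ)], sgn(v_τ − v_b)·(H(v_τ) − H(κ)) ≤ 0' holds if and only if H(v_τ) = max( H⁻(v_τ), H⁺(v_b) ). -/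
open Set

noncomputable section

/-- Appendix A: for quasiconvex fluxes the BLN boundary condition reduces to
`H(v_τ) = max(H⁻(v_τ), H⁺(v_b))`. -/
theorem stmt10 (H : ℝ → ℝ) (p0 : ℝ)
    (hHcont : Continuous H)
    (hHanti : AntitoneOn H (Iic p0))
    (hHmono : MonotoneOn H (Ici p0))
    (vτ vb : ℝ) :
    (∀ κ ∈ Icc (min vb vτ) (max vb vτ),
      Real.sign (vτ - vb) * (H vτ - H κ) ≤ 0) ↔
    H vτ = max (Hm H p0 vτ) (Hp H p0 vb) := by
  have A : ∀ a b, a ≤ b → b ≤ p0 → H b ≤ H a := fun a b h1 h2 =>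
    hHanti (mem_Iic.2 (h1.trans h2)) (mem_Iic.2 h2) h1
  have M : ∀ a b, p0 ≤ a → a ≤ b → H a ≤ H b := fun a b h1 h2 =>
    hHmono (mem_Ici.2 h1) (mem_Ici.2 (h1.trans h2)) h2
  have P : ∀ a, H p0 ≤ H a := fun a => by
    rcases le_total a p0 with h | h
    · exact A _ _ h le_rfl
    · exact M _ _ le_rfl h
  unfold Hm Hp
  rcases lt_trichotomy vτ vb with h | h | h
  · rw [Real.sign_of_neg (by linarith), min_eq_right h.le, max_eq_left h.le]
    rcases le_total p0 vτ with h0 | h0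
    · rw [min_eq_right h0, max_eq_left (h0.trans h.le), max_eq_right (P _)]
      constructor
      · intro hk
        have h1 := hk vb ⟨h.le, le_rfl⟩
        have h2 := M _ _ h0 h.le
        linarith
      · intro e κ hκ
        have h1 := M _ _ h0 hκ.1
        have h2 := M _ _ (h0.trans hκ.1) hκ.2
        linarith
    · rw [min_eq_left h0, eq_comm, max_eq_left_iff]
      constructor
      · intro hk
        rcases le_total vb p0 with h1 | h1
        · rw [max_eq_right h1]; exact P _
        · rw [max_eq_left h1]
          have h1 := hk vb ⟨h.le, le_rfl⟩
          linarith
      · intro e κ hκ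
        rcases le_total κ p0 with h1 | h1
        · have h2 := A _ _ hκ.1 h1
          linarith
        · rw [max_eq_left (h1.trans hκ.2)] at e
          have h2 := M _ _ h1 hκ.2
          linarith
  · subst h
    simp only [sub_self, Real.sign_zero, zero_mul, le_refl, implies_true, true_iff]
    rcases le_total vτ p0 with h1 | h1
    · rw [min_eq_left h1, max_eq_right h1, max_eq_left (P _)]
    · rw [min_eq_right h1, max_eq_left h1, max_eq_right (P _)]
  · rw [Real.sign_of_pos (by linarith), min_eq_left h.le, max_eq_right h.le]
    rcases le_total vτ p0 with h0 | h0
    · rw [min_eq_left h0, max_eq_right (h.le.trans h0), max_eq_left (P _)]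
      refine iff_of_true ?_ rfl
      intro κ hκ
      have h1 := A _ _ hκ.2 h0
      linarith
    · rw [min_eq_right h0, max_eq_right (P _)]
      constructor
      · intro hk
        have h1 := hk (max vb p0) ⟨le_max_left _ _, max_le h.le h0⟩
        have h2 := M (max vb p0) vτ (le_max_right _ _) (max_le h.le h0)
        linarith
      · intro e κ hκ
        rcases le_total κ p0 with h1 | h1
        · rw [max_eq_right (hκ.1.trans h1)] at e
          have h2 := P κ
          linarith
        · have h2 := M (max vb p0) κ (le_max_right _ _) (max_le hκ.1 h1)
          linarith
end
end

section
/- Extension of a junction function with controlled divergence (Appendix B Lemma). Let F : ℝ^N → ℝ be C¹ with ∂F/∂p_α(p) < 0 for every p ∈ ℝ^N and every α, and coercive (F(p) → +∞ as ∑_α max(−p_α, 0) → +∞). Let Q₀ := ∏_{α=1}^N [a_α, b_α] be a compact box (a_α ≤ b_α). Then there exists a function F̃ : ℝ^N → ℝ such that: (1) F̃ is locally Lipschitz; (2) F̃ = F on Q₀; (3) F̃ is strictly decreasing in each variable; (4) F̃ is coercive (F̃(p) → +∞ as ∑_α max(−p_α, 0) → +∞); (5) at every point p ∈ ℝ^N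 at which F̃ is differentiable, −∑_α ∂F̃/∂p_α(p) ≤ sup_{q ∈ Q₀} ( −∑_α ∂F/∂p_α(q) ). -/
open Set

noncomputable section

-- HELPERS
def psi11 (t : ℝ) : ℝ := max t 0 / (1 + max t 0)

lemma psi11_lip {s t : ℝ} (h : s ≤ t) : psi11 s ≤ psi11 t ∧ psi11 t - psi11 s ≤ max t 0 - max s 0 := by
  unfold psi11
  have h0 : 0 ≤ max s 0 := le_max_right _ _
  have h1 : max s 0 ≤ max t 0 := max_le_max_right 0 h
  generalize max s 0 = x at *
  generalize max t 0 = y at *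
  have e : y / (1 + y) - x / (1 + x) = (y - x) / ((1 + y) * (1 + x)) := by
    have hx : 1 + x ≠ 0 := (by linarith : 0 < 1 + x).ne'
    have hy : 1 + y ≠ 0 := (by linarith : 0 < 1 + y).ne'
    field_simp; ring
  have h2 : 0 ≤ (y - x) / ((1 + y) * (1 + x)) := by
    apply div_nonneg <;> nlinarith
  refine ⟨by linarith, ?_⟩
  rw [e]
  apply div_le_self <;> nlinarith

lemma psi11_strict {s t : ℝ} (h : s < t) (h0 : 0 < t) : psi11 s < psi11 t := by
  unfold psi11
  have h0' : 0 ≤ max s 0 := le_max_right _ _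
  have h1 : max s 0 < max t 0 := by
    rw [max_eq_left h0.le]; exact max_lt h h0
  generalize max s 0 = x at *
  generalize max t 0 = y at *
  rw [div_lt_div_iff₀ (by linarith) (by linarith)]
  nlinarith

lemma psi11_le (t : ℝ) : psi11 t ≤ 1 := by
  unfold psi11
  have h0' : 0 ≤ max t 0 := le_max_right _ _
  rw [div_le_one (by linarith)]; linarith

lemma psi11_zero {t : ℝ} (h : t ≤ 0) : psi11 t = 0 := by
  unfold psi11; rw [max_eq_right h]; simp

def cl11 (a b x : ℝ) : ℝ := max a (min x b)
def w11 (b x : ℝ) : ℝ := min x b + psi11 (x - b)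

lemma w11_strict {b s t : ℝ} (h : s < t) : w11 b s < w11 b t := by
  unfold w11
  have h1 : min s b ≤ min t b := min_le_min_right b h.le
  have h2 := (psi11_lip (sub_le_sub_right h.le b)).1
  rcases le_or_gt t b with h3 | h3
  · rw [min_eq_left h3, min_eq_left (by linarith)]; linarith
  · have := psi11_strict (sub_lt_sub_right h b) (by linarith : 0 < t - b)
    linarith

lemma w11_lip {b s t : ℝ} (h : s ≤ t) : w11 b t - w11 b s ≤ t - s := by
  unfold w11
  have h2 := (psi11_lip (sub_le_sub_right h b)).2
  have e : ∀ x : ℝ, min x b + max (x - b) 0 = x := by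
    intro x
    rcases le_total x b with h | h
    · rw [min_eq_left h, max_eq_right (by linarith)]; ring
    · rw [min_eq_right h, max_eq_left (by linarith)]; ring
  linarith [e s, e t]

lemma cl11_mono {a b s t : ℝ} (h : s ≤ t) : cl11 a b s ≤ cl11 a b t :=
  max_le_max_left a (min_le_min_right b h)

lemma cl11_lip {a b s t : ℝ} (h : s ≤ t) : cl11 a b t - cl11 a b s ≤ t - s := by
  unfold cl11
  rcases min_cases s b with h1 | h1 <;> rcases min_cases t b with h2 | h2 <;>
  rcases max_cases a (min s b) with h3 | h3 <;> rcases max_cases a (min t b) with h4 | h4 <;>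
  linarith

lemma cl11_mem {a b : ℝ} (h : a ≤ b) (x : ℝ) : cl11 a b x ∈ Icc a b :=
  ⟨le_max_left _ _, max_le h (min_le_right _ _)⟩

lemma cl11_eq {a b x : ℝ} (h : x ∈ Icc a b) : cl11 a b x = x := by
  unfold cl11; rw [min_eq_left h.2, max_eq_right h.1]

lemma w11_eq {b x : ℝ} (h : x ≤ b) : w11 b x = x := by
  unfold w11; rw [min_eq_left h, psi11_zero (by linarith)]; ring

lemma clw11 (a b x : ℝ) : max (-x) 0 - (|a| + 1) ≤ cl11 a b x - w11 b x := by
  unfold cl11 w11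
  have h := psi11_le (x - b)
  have h1 := neg_abs_le a
  have h2 := abs_nonneg a
  have h3 := le_max_left a (min x b)
  have h4 := le_max_right a (min x b)
  have h5 := min_le_left x b
  have : max (-x) 0 - |a| ≤ max a (min x b) - min x b := by
    rcases max_cases (-x) 0 with h | h <;> linarith
  linarith

lemma lip_pi11 {n : ℕ} (f : Fin n → ℝ → ℝ) (hm : ∀ i s t, s ≤ t → f i s ≤ f i t)
    (hl : ∀ i s t, s ≤ t → f i t - f i s ≤ t - s) :
    LipschitzWith 1 (fun p : Fin n → ℝ => fun i => f i (p i)) := by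
  refine LipschitzWith.of_dist_le_mul fun p q => ?_
  rw [NNReal.coe_one, one_mul, dist_pi_le_iff dist_nonneg]
  intro i
  refine le_trans ?_ (dist_le_pi_dist p q i)
  rw [Real.dist_eq, Real.dist_eq]
  rcases le_total (p i) (q i) with h | h
  · have h1 := hm i _ _ h
    have h2 := hl i _ _ h
    rw [abs_sub_comm, abs_sub_comm (p i), abs_of_nonneg (by linarith), abs_of_nonneg (by linarith)]
    exact h2
  · have h1 := hm i _ _ h
    have h2 := hl i _ _ h
    rw [abs_of_nonneg (by linarith), abs_of_nonneg (by linarith)]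
    exact h2

/-- Appendix B: extension of a junction function with controlled divergence. -/
theorem stmt11 (N : ℕ) (hN : 1 ≤ N)
    (F : (Fin N → ℝ) → ℝ)
    (hFC1 : ContDiff ℝ 1 F)
    (hFdec : ∀ (p : Fin N → ℝ) (α : Fin N), fderiv ℝ F p (Pi.single α 1) < 0)
    (hFcoer : ∀ M : ℝ, ∃ R : ℝ, ∀ p : Fin N → ℝ, R ≤ ∑ α, max (-p α) 0 → M ≤ F p)
    (a b : Fin N → ℝ) (hab : ∀ α, a α ≤ b α) :
    ∃ Ft : (Fin N → ℝ) → ℝ,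
      -- (1) locally Lipschitz
      LocallyLipschitz Ft ∧
      -- (2) F̃ = F on Q₀
      (∀ p : Fin N → ℝ, (∀ α, p α ∈ Icc (a α) (b α)) → Ft p = F p) ∧
      -- (3) strictly decreasing in each variable
      (∀ (α : Fin N) (p : Fin N → ℝ) (s t : ℝ), s < t →
        Ft (Function.update p α t) < Ft (Function.update p α s)) ∧
      -- (4) coercive
      (∀ M : ℝ, ∃ R : ℝ, ∀ p : Fin N → ℝ, R ≤ ∑ α, max (-p α) 0 → M ≤ Ft p) ∧
      -- (5) divergence control at differentiability points
      (∀ p : Fin N → ℝ, DifferentiableAt ℝ Ft p →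
        -∑ α, fderiv ℝ Ft p (Pi.single α 1) ≤
          sSup {x : ℝ | ∃ q : Fin N → ℝ, (∀ α, q α ∈ Icc (a α) (b α)) ∧
            x = -∑ α, fderiv ℝ F q (Pi.single α 1)}) := by
  set Q : Set (Fin N → ℝ) := Icc a b with hQ
  have hQm : ∀ q : Fin N → ℝ, (∀ α, q α ∈ Icc (a α) (b α)) ↔ q ∈ Q := by
    intro q
    simp only [hQ, mem_Icc, Pi.le_def, forall_and]
  have hQc : IsCompact Q := isCompact_Icc
  have hQne : Q.Nonempty := ⟨a, le_refl a, hab⟩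
  have hQconv : Convex ℝ Q := convex_Icc a b
  have hdc : ∀ v : Fin N → ℝ, Continuous fun q => fderiv ℝ F q v := fun v =>
    (hFC1.continuous_fderiv (by norm_num)).clm_apply continuous_const
  -- lower bound on slopes
  obtain ⟨δ, hδ, hδF⟩ : ∃ δ : ℝ, 0 < δ ∧ ∀ q ∈ Q, ∀ α, δ ≤ -fderiv ℝ F q (Pi.single α 1) := by
    have h1 : ∀ α : Fin N, ∃ d : ℝ, 0 < d ∧ ∀ q ∈ Q, d ≤ -fderiv ℝ F q (Pi.single α 1) := by
      intro α
      obtain ⟨q, _, hq⟩ := hQc.exists_isMinOn hQne (hdc (Pi.single α 1)).neg.continuousOn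
      exact ⟨_, neg_pos.2 (hFdec q α), fun r hr => hq hr⟩
    choose d hd hdq using h1
    haveI : Nonempty (Fin N) := ⟨⟨0, hN⟩⟩
    obtain ⟨i, hi⟩ := Finite.exists_min d
    exact ⟨d i, hd i, fun q hq α => (hi α).trans (hdq α q hq)⟩
  obtain ⟨m, hm⟩ : ∃ m : ℝ, ∀ q ∈ Q, m ≤ F q := by
    obtain ⟨q, _, hq⟩ := hQc.exists_isMinOn hQne hFC1.continuous.continuousOn
    exact ⟨F q, fun r hr => hq hr⟩
  set S : Set ℝ := {x : ℝ | ∃ q : Fin N → ℝ, (∀ α, q α ∈ Icc (a α) (b α)) ∧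
            x = -∑ α, fderiv ℝ F q (Pi.single α 1)} with hS
  have hSb : BddAbove S := by
    have h1 : BddAbove ((fun q => -∑ α, fderiv ℝ F q (Pi.single α 1)) '' Q) :=
      hQc.bddAbove_image
        (continuous_finsetSum _ fun α _ => hdc (Pi.single α 1)).neg.continuousOn
    refine h1.mono ?_
    rintro x ⟨q, hq, rfl⟩
    exact ⟨q, (hQm q).1 hq, rfl⟩
  have hL : ∀ q ∈ Q, -∑ α, fderiv ℝ F q (Pi.single α 1) ≤ sSup S := fun q hq =>
    le_csSup hSb ⟨q, (hQm q).2 hq, rfl⟩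
  have hmv : ∀ x ∈ Q, ∀ y ∈ Q, ∃ c ∈ Q,
      F x - F y = ∑ α, (-fderiv ℝ F c (Pi.single α 1)) * (y α - x α) := by
    intro x hx y hy
    obtain ⟨c, hc, hceq⟩ := domain_mvt (f := F) (f' := fun q => fderiv ℝ F q) (s := Q)
      (fun z _ => ((hFC1.differentiable (by norm_num)) z).hasFDerivAt.hasFDerivWithinAt)
      hQconv hx hy
    refine ⟨c, hQconv.segment_subset hx hy hc, ?_⟩
    have h2 := LinearMap.pi_apply_eq_sum_univ (fderiv ℝ F c).toLinearMap (y - x)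
    have h3 : fderiv ℝ F c (y - x) = ∑ α, (y α - x α) * fderiv ℝ F c (Pi.single α 1) := by
      refine h2.trans (Finset.sum_congr rfl fun α _ => ?_)
      simp only [smul_eq_mul, Pi.sub_apply]
      have e : (fun j => if α = j then (1 : ℝ) else 0) = Pi.single α 1 := by
        ext j
        simp [Pi.single_apply, eq_comm]
      rw [e]; rfl
    rw [h3] at hceq
    have : F x - F y = -∑ α, (y α - x α) * fderiv ℝ F c (Pi.single α 1) := by linarith
    rw [this, ← Finset.sum_neg_distrib]
    exact Finset.sum_congr rfl fun α _ => by ring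
  let π : (Fin N → ℝ) → (Fin N → ℝ) := fun p α => cl11 (a α) (b α) (p α)
  let W : (Fin N → ℝ) → (Fin N → ℝ) := fun p α => w11 (b α) (p α)
  have hπ : ∀ p, π p ∈ Q := fun p => (hQm _).1 fun α => cl11_mem (hab α) _
  let Ft : (Fin N → ℝ) → ℝ := fun p => F (π p) + δ * ∑ α, (π p α - W p α)
  have hdiff : ∀ p q, ∃ c ∈ Q, Ft p - Ft q =
      ∑ α, ((-fderiv ℝ F c (Pi.single α 1) - δ) * (π q α - π p α) + δ * (W q α - W p α)) := by
    intro p q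
    obtain ⟨c, hc, h⟩ := hmv (π p) (hπ p) (π q) (hπ q)
    refine ⟨c, hc, ?_⟩
    have : Ft p - Ft q = (F (π p) - F (π q)) + δ * (∑ α, (π p α - W p α) - ∑ α, (π q α - W q α)) := by
      simp only [Ft]; ring
    rw [this, h, ← Finset.sum_sub_distrib, Finset.mul_sum, ← Finset.sum_add_distrib]
    exact Finset.sum_congr rfl fun α _ => by ring
  refine ⟨Ft, ?_, ?_, ?_, ?_, ?_⟩
  · let G : (Fin N → ℝ) × (Fin N → ℝ) → ℝ := fun z => F z.1 + δ * ∑ α, (z.1 α - z.2 α)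
    have hG : ContDiff ℝ 1 G := by
      have : ContDiff ℝ 1 fun z : (Fin N → ℝ) × (Fin N → ℝ) => F z.1 := hFC1.comp contDiff_fst
      simp only [G]
      fun_prop
    have h1 : LipschitzWith 1 π := lip_pi11 (fun α => cl11 (a α) (b α))
      (fun _ _ _ h => cl11_mono h) (fun _ _ _ h => cl11_lip h)
    have h2 : LipschitzWith 1 W := lip_pi11 (fun α => w11 (b α))
      (fun α _ _ h => (show StrictMono (w11 (b α)) from fun _ _ h => w11_strict h).monotone h)
      (fun _ _ _ h => w11_lip h)
    exact hG.locallyLipschitz.comp (h1.prodMk h2).locallyLipschitz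
  · intro p hp
    have e1 : π p = p := funext fun α => cl11_eq (hp α)
    have e2 : W p = p := funext fun α => w11_eq (hp α).2
    simp only [Ft, e1, e2]; simp
  · intro α p s t hst
    rw [← sub_pos]
    obtain ⟨c, hc, h⟩ := hdiff (Function.update p α s) (Function.update p α t)
    rw [h]
    have hle : ∀ β, Function.update p α s β ≤ Function.update p α t β := by
      intro β
      by_cases hβ : β = α
      · subst hβ; simpa using hst.le
      · simp [hβ]
    have hk : ∀ β, 0 ≤ (-fderiv ℝ F c (Pi.single β 1) - δ) *
        (π (Function.update p α t) β - π (Function.update p α s) β) := fun β =>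
      mul_nonneg (sub_nonneg.2 (hδF c hc β)) (sub_nonneg.2 (cl11_mono (hle β)))
    refine Finset.sum_pos' (fun β _ => add_nonneg (hk β) (mul_nonneg hδ.le (sub_nonneg.2 ?_)))
      ⟨α, Finset.mem_univ _, add_pos_of_nonneg_of_pos (hk α) (mul_pos hδ (sub_pos.2 ?_))⟩
    · rcases (hle β).lt_or_eq with h | h
      · exact (w11_strict h).le
      · simp only [W, h]; exact le_refl _
    · simp only [W, Function.update_self]; exact w11_strict hst
  · intro M
    refine ⟨(M - m) / δ + ∑ α, (|a α| + 1), fun p hp => ?_⟩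
    have h1 : ∑ α, max (-p α) 0 - ∑ α, (|a α| + 1) ≤ ∑ α, (π p α - W p α) := by
      rw [← Finset.sum_sub_distrib]
      exact Finset.sum_le_sum fun α _ => clw11 _ _ _
    have h2 : (M - m) / δ ≤ ∑ α, (π p α - W p α) := by linarith
    rw [div_le_iff₀ hδ] at h2
    have h3 := hm _ (hπ p)
    simp only [Ft]
    linarith
  · intro p hp
    have key : ∀ (q r : Fin N → ℝ) (t : ℝ), 0 ≤ t → (∀ α, r α = q α + t) →
        Ft q - Ft r ≤ sSup S * t := by
      intro q r t ht hr
      obtain ⟨c, hc, h⟩ := hdiff q r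
      rw [h]
      refine le_trans ?_ (mul_le_mul_of_nonneg_right (hL c hc) ht)
      rw [← Finset.sum_neg_distrib, Finset.sum_mul]
      refine Finset.sum_le_sum fun α _ => ?_
      have hle : q α ≤ r α := by rw [hr]; linarith
      have e1 : π r α - π q α ≤ t := (cl11_lip hle).trans (by rw [hr]; linarith)
      have e2 : W r α - W q α ≤ t := (w11_lip hle).trans (by rw [hr]; linarith)
      have := mul_le_mul_of_nonneg_left e1 (sub_nonneg.2 (hδF c hc α))
      have := mul_le_mul_of_nonneg_left e2 hδ.le
      linarith
    let g : ℝ → ℝ := fun t => Ft (p + t • (1 : Fin N → ℝ)) + sSup S * t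
    have hg : Monotone g := by
      intro s t hst
      have := key (p + s • (1 : Fin N → ℝ)) (p + t • (1 : Fin N → ℝ)) (t - s) (by linarith)
        (fun α => by simp)
      simp only [g]; linarith
    have hd : HasDerivAt g (fderiv ℝ Ft p 1 + sSup S * 1) 0 := by
      have h1 := hp.hasFDerivAt.hasLineDerivAt (1 : Fin N → ℝ)
      exact HasDerivAt.add h1 ((hasDerivAt_id (0:ℝ)).const_mul _)
    have h0 : 0 ≤ deriv g 0 := hg.deriv_nonneg
    rw [hd.deriv] at h0
    have h1 : fderiv ℝ Ft p 1 = ∑ α, fderiv ℝ Ft p (Pi.single α 1) := by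
      rw [← map_sum]
      congr 1
      exact (Finset.univ_sum_single (1 : Fin N → ℝ)).symm
    linarith
end
end
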